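/- Fix j ∈ {1, …, N} and assume the boundary curve Γ_j = ∂G_j is an analytic Jordan curve. Then there exist a sequence (γ_n) with 0 < γ_n < 1 for all n, constants C > 0 and α ∈ (0,1) with γ_n ≤ C·α^n for all n (so γ_n → 0 geometrically), and an integer m ≥ 1, such that for every n ∈ ℕ and every z in the closure of G_j one has ((1 − γ_n)/2)·Λ_{m·n}(z) ≤ Λ_n^{G_j}(z). -/

import Mathlib

open MeasureTheory Filter Polynomial Set Metric

noncomputable section

/-- A Jordan curve: the range of an injective continuous map from the unit circle into `ℂ`. -/
def IsJordanCurve (C : Set ℂ) : Prop :=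
  ∃ f : ℂ → ℂ, ContinuousOn f (sphere (0:ℂ) 1) ∧ InjOn f (sphere (0:ℂ) 1) ∧
    C = f '' sphere (0:ℂ) 1

/-- A Jordan domain: the bounded connected component of the complement of a Jordan curve. -/
def IsJordanDomain (D : Set ℂ) : Prop :=
  ∃ C : Set ℂ, IsJordanCurve C ∧ Bornology.IsBounded D ∧
    ∃ z ∈ Cᶜ, D = connectedComponentIn Cᶜ z

/-- An archipelago: a finite family of Jordan domains with mutually disjoint closures. -/
def IsArchipelago {N : ℕ} (Gs : Fin N → Set ℂ) : Prop :=
  (∀ j, IsJordanDomain (Gs j)) ∧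
  ∀ j k, j ≠ k → Disjoint (closure (Gs j)) (closure (Gs k))

/-- `P n` is the Bergman orthonormal polynomial of degree `n` for `G`, with positive real
leading coefficient `lam n`, and the family is orthonormal in `L²(G, dA)`. -/
def IsBergmanSystem (G : Set ℂ) (P : ℕ → Polynomial ℂ) (lam : ℕ → ℝ) : Prop :=
  (∀ n, (P n).natDegree = n) ∧
  (∀ n, 0 < lam n ∧ (P n).leadingCoeff = (lam n : ℂ)) ∧
  ∀ n k, (∫ z in G, (P n).eval z * (starRingEnd ℂ) ((P k).eval z)) =
    if n = k then 1 else 0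

/-- An analytic Jordan curve: the image of the unit circle under a map that is holomorphic
and injective on an open neighborhood of the unit circle. -/
def IsAnalyticJordanCurve (C : Set ℂ) : Prop :=
  ∃ (U : Set ℂ) (f : ℂ → ℂ), IsOpen U ∧ sphere (0:ℂ) 1 ⊆ U ∧
    DifferentiableOn ℂ f U ∧ InjOn f U ∧ C = f '' sphere (0:ℂ) 1

/-- `u` has a continuous logarithm on `K`. -/
def HasLogOn (u : ℂ → ℂ) (K : Set ℂ) : Prop :=
  ∃ g : ℂ → ℂ, ContinuousOn g K ∧ ∀ z ∈ K, Complex.exp (g z) = u z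

theorem HasLogOn.mono {u : ℂ → ℂ} {K L : Set ℂ} (h : HasLogOn u L) (hKL : K ⊆ L) :
    HasLogOn u K := by
  obtain ⟨g, hg, hgu⟩ := h
  exact ⟨g, hg.mono hKL, fun z hz => hgu z (hKL hz)⟩

theorem exists_continuous_log {A : Type*} [TopologicalSpace A] [SimplyConnectedSpace A]
    [LocallyPathConnectedSpace A] {u : A → ℂ} (hu : Continuous u) (h0 : ∀ a, u a ≠ 0) :
    ∃ g : A → ℂ, Continuous g ∧ ∀ a, Complex.exp (g a) = u a := by
  obtain ⟨a₀⟩ : Nonempty A := inferInstance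
  obtain ⟨F, ⟨-, hF⟩, -⟩ := Complex.isCoveringMapOn_exp.existsUnique_continuousMap_lifts
    (⟨u, hu⟩ : C(A, ℂ)) (a₀ := a₀) (e₀ := Complex.log (u a₀)) (Complex.exp_log (h0 a₀))
    (fun a => h0 a)
  exact ⟨F, F.continuous, fun a => congrFun hF a⟩

theorem sub_eq_sub_of_exp_eq {A : Type*} [TopologicalSpace A] [PreconnectedSpace A]
    {g h : A → ℂ} (hg : Continuous g) (hh : Continuous h)
    (he : ∀ a, Complex.exp (g a) = Complex.exp (h a)) (a b : A) :
    g a - h a = g b - h b := by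
  have hb : Complex.exp (g b - h b) = 1 := by
    rw [Complex.exp_sub, he, div_self (Complex.exp_ne_zero _)]
  have := Complex.isCoveringMap_exp.eq_of_comp_eq hg (hh.add_const (g b - h b))
    (by
      ext x
      simp only [Function.comp, he, Complex.exp_add, hb, mul_one]) b (by ring)
  rw [congrFun this a]
  ring

theorem frontier_connectedComponentIn_subset {F : Set ℂ} (hF : IsOpen F) (z : ℂ) :
    frontier (connectedComponentIn F z) ⊆ Fᶜ := by
  intro y hy hyF
  have hW : IsOpen (connectedComponentIn F y) := hF.connectedComponentIn
  have hyW := mem_connectedComponentIn hyF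
  obtain ⟨x, hxW, hxV⟩ := mem_closure_iff.1 hy.1 _ hW hyW
  have h := (connectedComponentIn_eq hxW).trans (connectedComponentIn_eq hxV).symm
  rw [h] at hyW
  exact hy.2 (by rwa [(hF.connectedComponentIn).interior_eq])

/-- A function which is `(z - a) ^ p` times a zero-free factor on a bounded open set containing `a`
has no continuous logarithm on the boundary unless `p = 0`. -/
theorem eq_zero_of_hasLogOn_frontier {V : Set ℂ} (hVo : IsOpen V) (hVb : Bornology.IsBounded V)
    {a : ℂ} (ha : a ∈ V) {p : ℤ} {v : ℂ → ℂ} (hv : ContinuousOn v (closure V))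
    (hv0 : ∀ z ∈ closure V, v z ≠ 0)
    (hlog : HasLogOn (fun z => (z - a) ^ p * v z) (frontier V)) : p = 0 := by
  classical
  obtain ⟨g, hg, hgu⟩ := hlog
  obtain ⟨G, hG⟩ := ContinuousMap.exists_restrict_eq (isClosed_frontier (s := V))
    (⟨fun z => g z, hg.domRestrict⟩ : C(frontier V, ℂ))
  have hGg : ∀ z ∈ frontier V, G z = g z := fun z hz => DFunLike.congr_fun hG ⟨z, hz⟩
  have hcompl : closure {x | ¬ x ∈ V} = Vᶜ := hVo.isClosed_compl.closure_eq
  have hphi : Continuous (fun z => if z ∈ V then Complex.exp (G z) / v z else (z - a) ^ p) := by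
    refine continuous_if ?_ ?_ ?_
    · intro z hz
      have hz' : z ∈ frontier V := hz
      rw [hGg z hz', hgu z hz', mul_div_assoc, div_self (hv0 z hz'.1), mul_one]
    · exact (Complex.continuous_exp.comp G.continuous).continuousOn.div hv hv0
    · rw [hcompl]
      intro z hz
      refine ((continuousAt_id.sub continuousAt_const).zpow₀ p (Or.inl ?_)).continuousWithinAt
      exact sub_ne_zero.2 fun h : z = a => hz (h ▸ ha)
  obtain ⟨ψ, hψ, hψe⟩ := exists_continuous_log hphi (by
    intro z
    by_cases hz : z ∈ V
    · simpa [hz] using hv0 z (subset_closure hz)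
    · simp only [hz, if_false]
      exact zpow_ne_zero _ (sub_ne_zero.2 fun h => hz (h ▸ ha)))
  obtain ⟨R, hR0, hR⟩ := hVb.subset_ball_lt 0 a
  have hout : ∀ t : ℝ, a + R * Complex.exp (t * Complex.I) ∉ V := by
    intro t ht
    have := hR ht
    rw [mem_ball, dist_eq_norm, add_sub_cancel_left, norm_mul, Complex.norm_exp_ofReal_mul_I,
      Complex.norm_real, Real.norm_eq_abs, abs_of_pos hR0, mul_one] at this
    exact lt_irrefl _ this
  have h2 : ∀ t : ℝ, Complex.exp (ψ (a + R * Complex.exp (t * Complex.I)))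
      = Complex.exp (p * (Real.log R + t * Complex.I)) := by
    intro t
    rw [hψe, if_neg (hout t), add_sub_cancel_left, Complex.exp_int_mul, Complex.exp_add,
      ← Complex.ofReal_exp, Real.exp_log hR0]
  have h3 := sub_eq_sub_of_exp_eq (A := ℝ) (by fun_prop) (by fun_prop) h2 0 (2 * Real.pi)
  have e0 : Complex.exp ((0 : ℝ) * Complex.I) = 1 := by simp
  have e1 : Complex.exp ((2 * Real.pi : ℝ) * Complex.I) = 1 := by
    push_cast; exact Complex.exp_two_pi_mul_I
  rw [e0, e1, Complex.ofReal_zero] at h3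
  have h4 : (p : ℂ) * ((2 * Real.pi : ℝ) * Complex.I) = 0 := by
    linear_combination h3
  simpa [Real.pi_ne_zero] using h4

theorem HasLogOn.congr_mul {u w : ℂ → ℂ} {K : Set ℂ} (hu : HasLogOn u K)
    (hw : ContinuousOn w K) (hws : ∀ z ∈ K, w z ∈ Complex.slitPlane) :
    HasLogOn (fun z => u z * w z) K := by
  obtain ⟨g, hg, hgu⟩ := hu
  refine ⟨fun z => g z + Complex.log (w z), hg.add (hw.clog hws), fun z hz => ?_⟩
  rw [Complex.exp_add, hgu z hz, Complex.exp_log (Complex.slitPlane_ne_zero (hws z hz))]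

theorem HasLogOn.sub_of_norm_lt {K : Set ℂ} {w w' : ℂ}
    (h : HasLogOn (fun z => z - w) K) (hlt : ∀ z ∈ K, ‖w - w'‖ < ‖z - w‖) :
    HasLogOn (fun z => z - w') K := by
  have hne : ∀ z ∈ K, z - w ≠ 0 := fun z hz h0 => by
    have := hlt z hz
    rw [h0, norm_zero] at this
    exact absurd this (not_lt.2 (norm_nonneg _))
  have := h.congr_mul (w := fun z => 1 + (w - w') / (z - w))
    (continuousOn_const.add (continuousOn_const.div (by fun_prop) hne)) (fun z hz => by
      refine Complex.mem_slitPlane_of_norm_lt_one ?_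
      rw [norm_div, div_lt_one (lt_of_le_of_lt (norm_nonneg _) (hlt z hz))]
      exact hlt z hz)
  obtain ⟨g, hg, hgu⟩ := this
  refine ⟨g, hg, fun z hz => (hgu z hz).trans ?_⟩
  have := hne z hz
  field_simp
  ring

theorem hasLogOn_sub_of_unbounded {K V : Set ℂ} (hK : IsCompact K) (hV : IsPreconnected V)
    (hVb : ¬ Bornology.IsBounded V) (hdisj : Disjoint V K) {w : ℂ} (hw : w ∈ V) :
    HasLogOn (fun z => z - w) K := by
  obtain ⟨R, hR⟩ := hK.isBounded.subset_ball 0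
  obtain ⟨w₀, hw₀V, hw₀⟩ : ∃ w₀ ∈ V, w₀ ∉ ball (0 : ℂ) R := by
    by_contra! hcon
    exact hVb (isBounded_ball.subset hcon)
  have hbase : HasLogOn (fun z => z - w₀) K := by
    have hlt : ∀ z ∈ K, ‖z‖ < ‖w₀‖ := fun z hz => by
      have h1 := hR hz
      rw [mem_ball_zero_iff] at h1 hw₀
      linarith
    refine ⟨fun z => Complex.log (-w₀) + Complex.log (1 + -(z / w₀)), ?_, fun z hz => ?_⟩
    · refine continuousOn_const.add (ContinuousOn.clog (by fun_prop) fun z hz => ?_)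
      refine Complex.mem_slitPlane_of_norm_lt_one ?_
      rw [norm_neg, norm_div, div_lt_one (lt_of_le_of_lt (norm_nonneg _) (hlt z hz))]
      exact hlt z hz
    · have hw0 : w₀ ≠ 0 := norm_pos_iff.1 (lt_of_le_of_lt (norm_nonneg _) (hlt z hz))
      have h1 : 1 + -(z / w₀) ≠ 0 := by
        refine Complex.slitPlane_ne_zero (Complex.mem_slitPlane_of_norm_lt_one ?_)
        rw [norm_neg, norm_div, div_lt_one (lt_of_le_of_lt (norm_nonneg _) (hlt z hz))]
        exact hlt z hz
      rw [Complex.exp_add, Complex.exp_log (neg_ne_zero.2 hw0), Complex.exp_log h1]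
      field_simp
      ring
  refine (hV.induction₂ (fun x y => HasLogOn (fun z => z - x) K ↔ HasLogOn (fun z => z - y) K)
    ?_ (fun x y z _ _ _ h1 h2 => h1.trans h2) (fun x y _ _ h => h.symm) hw₀V hw).1 hbase
  intro x hx
  have hxK : x ∈ Kᶜ := fun h => hdisj.le_bot ⟨hx, h⟩
  obtain ⟨ε, hε, hball⟩ := Metric.isOpen_iff.1 hK.isClosed.isOpen_compl x hxK
  refine mem_nhdsWithin_of_mem_nhds ?_
  filter_upwards [Metric.ball_mem_nhds x (half_pos hε)] with y hy
  have hfar : ∀ z ∈ K, ε ≤ ‖z - x‖ := fun z hz => by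
    by_contra! hcon
    exact hball (by simpa [dist_eq_norm] using hcon) hz
  rw [mem_ball, dist_eq_norm] at hy
  constructor
  · intro h
    refine h.sub_of_norm_lt fun z hz => ?_
    have := hfar z hz
    rw [norm_sub_rev]
    linarith
  · intro h
    refine h.sub_of_norm_lt fun z hz => ?_
    have h1 := hfar z hz
    have h2 : ‖z - x‖ ≤ ‖z - y‖ + ‖y - x‖ := norm_sub_le_norm_sub_add_norm_sub _ _ _
    linarith

theorem exists_continuousOn_inverse_of_injOn_sphere {f : ℂ → ℂ}
    (hf : ContinuousOn f (sphere (0:ℂ) 1)) (hinj : InjOn f (sphere (0:ℂ) 1)) :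
    ∃ φ : ℂ → ℂ, ContinuousOn φ (f '' sphere (0:ℂ) 1) ∧
      (∀ s ∈ sphere (0:ℂ) 1, φ (f s) = s) := by
  have hl : ∀ s ∈ sphere (0:ℂ) 1, Function.invFunOn f (sphere (0:ℂ) 1) (f s) = s :=
    fun s hs => hinj.leftInvOn_invFunOn hs
  refine ⟨Function.invFunOn f (sphere (0:ℂ) 1), ?_, hl⟩
  rw [continuousOn_iff_isClosed]
  intro t ht
  refine ⟨f '' (sphere 0 1 ∩ t), ?_, ?_⟩
  · exact (((isCompact_sphere (0:ℂ) 1).inter_right ht).image_of_continuousOn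
      (hf.mono inter_subset_left)).isClosed
  · ext z
    constructor
    · rintro ⟨hz, s, hs, rfl⟩
      rw [mem_preimage, hl s hs] at hz
      exact ⟨⟨s, ⟨hs, hz⟩, rfl⟩, s, hs, rfl⟩
    · rintro ⟨⟨s, ⟨hs, hst⟩, rfl⟩, hz⟩
      exact ⟨by rwa [mem_preimage, hl s hs], hz⟩

theorem exp_arg_mul_I_of_mem_sphere {s : ℂ} (hs : s ∈ sphere (0:ℂ) 1) :
    Complex.exp (s.arg * Complex.I) = s := by
  have := Complex.norm_mul_exp_arg_mul_I s
  rwa [mem_sphere_zero_iff_norm.1 hs, Complex.ofReal_one, one_mul] at this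

theorem exp_ofReal_mul_I_mem_sphere (t : ℝ) :
    Complex.exp (t * Complex.I) ∈ sphere (0:ℂ) 1 := by
  rw [mem_sphere_zero_iff_norm, Complex.norm_exp_ofReal_mul_I]

/-- A periodic logarithm along a parametrized Jordan curve descends to the curve. -/
theorem hasLogOn_of_periodic {f u : ℂ → ℂ} (hf : ContinuousOn f (sphere (0:ℂ) 1))
    (hinj : InjOn f (sphere (0:ℂ) 1)) {L : ℝ → ℂ} (hL : Continuous L)
    (hper : Function.Periodic L (2 * Real.pi))
    (hLu : ∀ t : ℝ, Complex.exp (L t) = u (f (Complex.exp (t * Complex.I)))) :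
    HasLogOn u (f '' sphere (0:ℂ) 1) := by
  obtain ⟨φ, hφ, hφf⟩ := exists_continuousOn_inverse_of_injOn_sphere hf hinj
  have hlift : Continuous (fun θ : Real.Angle => hper.lift θ) := continuous_coinduced_dom.2 hL
  refine ⟨fun z => hper.lift ((φ z).arg : Real.Angle), ?_, ?_⟩
  · refine hlift.comp_continuousOn ?_
    rintro _ ⟨s, hs, rfl⟩
    have hs0 : φ (f s) ≠ 0 := by
      rw [hφf s hs]
      exact ne_of_mem_sphere hs one_ne_zero
    exact (Complex.continuousAt_arg_coe_angle hs0).comp_continuousWithinAt (hφ _ ⟨s, hs, rfl⟩)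
  · rintro _ ⟨s, hs, rfl⟩
    have : hper.lift ((φ (f s)).arg : Real.Angle) = L s.arg := by
      rw [hφf s hs]; exact hper.lift_coe _
    exact (congrArg Complex.exp this).trans (by rw [hLu, exp_arg_mul_I_of_mem_sphere hs])

theorem hasLogOn_diff_singleton {f u : ℂ → ℂ} (hf : ContinuousOn f (sphere (0:ℂ) 1))
    (hinj : InjOn f (sphere (0:ℂ) 1)) (hu : Continuous u)
    (hu0 : ∀ z ∈ f '' sphere (0:ℂ) 1, u z ≠ 0) {w : ℂ} (hw : w ∈ f '' sphere (0:ℂ) 1) :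
    HasLogOn u (f '' sphere (0:ℂ) 1 \ {w}) := by
  obtain ⟨φ, hφ, hφf⟩ := exists_continuousOn_inverse_of_injOn_sphere hf hinj
  obtain ⟨s₀, hs₀, rfl⟩ := hw
  have hcomp : Continuous (fun t : ℝ => u (f (-s₀ * Complex.exp (t * Complex.I)))) := by
    refine hu.comp (hf.comp_continuous (by fun_prop) fun t => ?_)
    rw [mem_sphere_zero_iff_norm, norm_mul, norm_neg, mem_sphere_zero_iff_norm.1 hs₀,
      Complex.norm_exp_ofReal_mul_I, one_mul]
  have hs₀0 : s₀ ≠ 0 := ne_of_mem_sphere hs₀ one_ne_zero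
  have hmem : ∀ t : ℝ, -s₀ * Complex.exp (t * Complex.I) ∈ sphere (0:ℂ) 1 := fun t => by
    rw [mem_sphere_zero_iff_norm, norm_mul, norm_neg, mem_sphere_zero_iff_norm.1 hs₀,
      Complex.norm_exp_ofReal_mul_I, one_mul]
  obtain ⟨L, hL, hLu⟩ := exists_continuous_log hcomp (fun t => hu0 _ ⟨_, hmem t, rfl⟩)
  refine ⟨fun z => L (φ z / (-s₀)).arg, ?_, ?_⟩
  · refine hL.comp_continuousOn ?_
    rintro _ ⟨⟨s, hs, rfl⟩, hne⟩
    have hslit : φ (f s) / (-s₀) ∈ Complex.slitPlane := by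
      rw [hφf s hs, Complex.mem_slitPlane_iff_arg]
      have hs' : s / (-s₀) ∈ sphere (0:ℂ) 1 := by
        rw [mem_sphere_zero_iff_norm, norm_div, norm_neg, mem_sphere_zero_iff_norm.1 hs₀,
          mem_sphere_zero_iff_norm.1 hs, div_one]
      refine ⟨fun harg => hne ?_, ne_of_mem_sphere hs' one_ne_zero⟩
      have h1 := exp_arg_mul_I_of_mem_sphere hs'
      rw [harg, Complex.exp_pi_mul_I, eq_div_iff (neg_ne_zero.2 hs₀0)] at h1
      rw [mem_singleton_iff, ← h1]
      simp
    exact ContinuousAt.comp_continuousWithinAt (f := fun z => φ z / -s₀)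
      (Complex.continuousAt_arg hslit) (((hφ _ ⟨s, hs, rfl⟩).mono sdiff_subset).div_const _)
  · rintro _ ⟨⟨s, hs, rfl⟩, -⟩
    have hs' : s / (-s₀) ∈ sphere (0:ℂ) 1 := by
      rw [mem_sphere_zero_iff_norm, norm_div, norm_neg, mem_sphere_zero_iff_norm.1 hs₀,
        mem_sphere_zero_iff_norm.1 hs, div_one]
    rw [hLu, hφf s hs, exp_arg_mul_I_of_mem_sphere hs', mul_div_cancel₀ _ (neg_ne_zero.2 hs₀0)]

theorem exists_add_two_pi_of_log {u : ℂ → ℂ} {L : ℝ → ℂ} (hL : Continuous L)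
    (hLu : ∀ t : ℝ, Complex.exp (L t) = u (Complex.exp (t * Complex.I))) :
    ∃ n : ℤ, ∀ t, L (t + 2 * Real.pi) = L t + n * (2 * Real.pi * Complex.I) := by
  have he : ∀ t : ℝ, Complex.exp (L (t + 2 * Real.pi)) = Complex.exp (L t) := fun t => by
    rw [hLu, hLu]
    congr 1
    push_cast
    rw [add_mul, Complex.exp_add, Complex.exp_two_pi_mul_I, mul_one]
  obtain ⟨n, hn⟩ := Complex.exp_eq_exp_iff_exists_int.1 (he 0)
  refine ⟨n, fun t => ?_⟩
  have := sub_eq_sub_of_exp_eq (A := ℝ) (by fun_prop) hL he t 0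
  linear_combination this + hn

/-- On a Jordan curve, any two zero-free functions are multiplicatively dependent modulo
exponentials. -/
theorem exists_zpow_mul_zpow_hasLogOn {f u v : ℂ → ℂ} (hf : ContinuousOn f (sphere (0:ℂ) 1))
    (hinj : InjOn f (sphere (0:ℂ) 1)) (hu : Continuous u) (hv : Continuous v)
    (hu0 : ∀ z ∈ f '' sphere (0:ℂ) 1, u z ≠ 0) (hv0 : ∀ z ∈ f '' sphere (0:ℂ) 1, v z ≠ 0) :
    ∃ p q : ℤ, (p ≠ 0 ∨ q ≠ 0) ∧
      HasLogOn (fun z => u z ^ p * v z ^ q) (f '' sphere (0:ℂ) 1) := by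
  have hc : Continuous (fun t : ℝ => f (Complex.exp (t * Complex.I))) :=
    hf.comp_continuous (by fun_prop) exp_ofReal_mul_I_mem_sphere
  obtain ⟨L, hL, hLu⟩ := exists_continuous_log (hu.comp hc)
    (fun t => hu0 _ ⟨_, exp_ofReal_mul_I_mem_sphere t, rfl⟩)
  obtain ⟨M, hM, hMv⟩ := exists_continuous_log (hv.comp hc)
    (fun t => hv0 _ ⟨_, exp_ofReal_mul_I_mem_sphere t, rfl⟩)
  obtain ⟨n, hn⟩ := exists_add_two_pi_of_log (u := u ∘ f) hL hLu
  obtain ⟨m, hm⟩ := exists_add_two_pi_of_log (u := v ∘ f) hM hMv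
  have key : ∀ p q : ℤ, p * n + q * m = 0 →
      HasLogOn (fun z => u z ^ p * v z ^ q) (f '' sphere (0:ℂ) 1) := by
    intro p q hpq
    refine hasLogOn_of_periodic hf hinj (L := fun t => p * L t + q * M t) (by fun_prop) ?_ ?_
    · intro t
      have : (p : ℂ) * n + q * m = 0 := by exact_mod_cast hpq
      simp only [hn, hm]
      linear_combination (2 * Real.pi * Complex.I) * this
    · intro t
      rw [Complex.exp_add, Complex.exp_int_mul, Complex.exp_int_mul, hLu, hMv]
      rfl
  by_cases hm0 : m = 0
  · exact ⟨0, 1, Or.inr one_ne_zero, key 0 1 (by simp [hm0])⟩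
  · exact ⟨m, -n, Or.inl hm0, key m (-n) (by ring)⟩

/-- The closure of a Jordan domain has no holes. -/
theorem IsJordanDomain.hasLogOn_closure {D : Set ℂ} (hD : IsJordanDomain D) {w : ℂ}
    (hw : w ∉ closure D) : HasLogOn (fun z => z - w) (closure D) := by
  obtain ⟨C, ⟨f, hf, hinj, rfl⟩, hDb, a, ha, hDa⟩ := hD
  have hCc : IsCompact (f '' sphere (0:ℂ) 1) := (isCompact_sphere (0:ℂ) 1).image_of_continuousOn hf
  have hCo : IsOpen (f '' sphere (0:ℂ) 1)ᶜ := hCc.isClosed.isOpen_compl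
  have hDo : IsOpen D := hDa ▸ hCo.connectedComponentIn
  have haD : a ∈ D := hDa ▸ mem_connectedComponentIn ha
  have hfr : frontier D ⊆ f '' sphere (0:ℂ) 1 := by
    simpa [← hDa] using frontier_connectedComponentIn_subset hCo a
  have ha0 : ∀ z ∈ f '' sphere (0:ℂ) 1, z - a ≠ 0 := fun z hz h =>
    ha (sub_eq_zero.1 h ▸ hz)
  have hwC : w ∉ f '' sphere (0:ℂ) 1 := by
    intro hwC
    have hlog := (hasLogOn_diff_singleton hf hinj (u := fun z => z - a) (by fun_prop) ha0
      hwC).mono (K := frontier D) fun z hz => ⟨hfr hz, fun h => hw (by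
        rw [mem_singleton_iff] at h
        exact h ▸ hz.1)⟩
    exact one_ne_zero (eq_zero_of_hasLogOn_frontier hDo hDb haD (p := 1) (v := fun _ => 1)
      continuousOn_const (fun _ _ => one_ne_zero) (by simpa using hlog))
  set V := connectedComponentIn (f '' sphere (0:ℂ) 1)ᶜ w with hV
  have hVo : IsOpen V := hCo.connectedComponentIn
  have hwV : w ∈ V := mem_connectedComponentIn hwC
  have hVD : Disjoint V D := by
    rw [Set.disjoint_left]
    intro x hxV hxD
    rw [hDa] at hxD
    have h := (connectedComponentIn_eq hxV).trans (connectedComponentIn_eq hxD).symm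
    exact hw (subset_closure (by rw [hDa, ← h]; exact hwV))
  have hVC : Disjoint V (f '' sphere (0:ℂ) 1) :=
    Set.disjoint_left.2 fun x hx => connectedComponentIn_subset _ _ hx
  have hVcl : Disjoint V (closure D) := hVD.closure_right hVo
  refine hasLogOn_sub_of_unbounded hDb.isCompact_closure isPreconnected_connectedComponentIn
    ?_ hVcl hwV
  intro hVb
  have hVfr : frontier V ⊆ f '' sphere (0:ℂ) 1 := by
    simpa using frontier_connectedComponentIn_subset hCo w
  obtain ⟨p, q, hpq, hlog⟩ := exists_zpow_mul_zpow_hasLogOn hf hinj (u := fun z => z - a)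
    (v := fun z => z - w) (by fun_prop) (by fun_prop) ha0
    (fun z hz h => hwC (sub_eq_zero.1 h ▸ hz))
  have hne : ∀ {b : ℂ} {W : Set ℂ} (k : ℤ), b ∉ closure W →
      ContinuousOn (fun z => (z - b) ^ k) (closure W) ∧
        ∀ z ∈ closure W, (z - b) ^ k ≠ 0 := by
    intro b W k hb
    have h0 : ∀ z ∈ closure W, z - b ≠ 0 := fun z hz h => hb (sub_eq_zero.1 h ▸ hz)
    exact ⟨ContinuousOn.zpow₀ (by fun_prop) k fun z hz => Or.inl (h0 z hz),
      fun z hz => zpow_ne_zero _ (h0 z hz)⟩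
  rcases hpq with hp | hq
  · obtain ⟨h1, h2⟩ := hne q hw
    exact hp (eq_zero_of_hasLogOn_frontier hDo hDb haD h1 h2 (hlog.mono hfr))
  · have haV : a ∉ closure V := fun h => (hVD.symm.closure_right hDo).le_bot ⟨haD, h⟩
    obtain ⟨h1, h2⟩ := hne p haV
    refine hq (eq_zero_of_hasLogOn_frontier hVo hVb hwV h1 h2 ?_)
    simpa only [mul_comm] using hlog.mono hVfr

theorem isUnit_algebraMap_sub_of_hasLogOn {K : Set ℂ} [CompactSpace K]
    (hlog : ∀ w ∉ K, HasLogOn (fun z => z - w) K) {ζ : ℂ} (hζ : ζ ∉ K)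
    (x : (polynomialFunctions K).topologicalClosure)
    (hx : ∀ w : K, (x : C(K, ℂ)) w = w) :
    IsUnit (algebraMap ℂ (polynomialFunctions K).topologicalClosure ζ - x) := by
  have hK : IsCompact K := isCompact_iff_compactSpace.2 inferInstance
  by_contra hcon
  have hmem : ζ ∈ spectrum ℂ x := hcon
  have hspec : spectrum ℂ (x : C(K, ℂ)) = K := by
    rw [ContinuousMap.spectrum_eq_range]
    ext w
    simp only [mem_range, hx]
    exact ⟨fun ⟨y, hy⟩ => hy ▸ y.2, fun hw => ⟨⟨w, hw⟩, rfl⟩⟩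
  have : IsClosed ((polynomialFunctions K).topologicalClosure : Set C(K, ℂ)) :=
    Subalgebra.isClosed_topologicalClosure _
  have hb := Subalgebra.spectrum_isBounded_connectedComponentIn _ x hmem
  rw [hspec] at hb
  have hKo : IsOpen Kᶜ := hK.isClosed.isOpen_compl
  refine one_ne_zero (eq_zero_of_hasLogOn_frontier hKo.connectedComponentIn hb
    (mem_connectedComponentIn hζ) (p := 1) (v := fun _ => 1) continuousOn_const
    (fun _ _ => one_ne_zero) ?_)
  have := (hlog ζ hζ).mono (by simpa using frontier_connectedComponentIn_subset hKo ζ)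
  simpa using this

/-- Cauchy-type integrals over a curve off a compact set without holes are continuous on that set
and are uniform limits of polynomials there. -/
theorem continuousOn_and_exists_polynomial_of_circleIntegral {K : Set ℂ} (hK : IsCompact K)
    (hlog : ∀ w ∉ K, HasLogOn (fun z => z - w) K) {ρ : ℝ} (hρ : 0 ≤ ρ) {f g : ℂ → ℂ}
    (hf : ContinuousOn f (sphere (0:ℂ) ρ)) (hg : ContinuousOn g (sphere (0:ℂ) ρ))
    (hfK : ∀ z ∈ sphere (0:ℂ) ρ, f z ∉ K) :
    ContinuousOn (fun w => ∮ z in C(0, ρ), g z * (f z - w)⁻¹) K ∧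
    ∀ ε > 0, ∃ p : Polynomial ℂ, ∀ w ∈ K,
      ‖p.eval w - ∮ z in C(0, ρ), g z * (f z - w)⁻¹‖ < ε := by
  have : CompactSpace K := isCompact_iff_compactSpace.1 hK
  set A := (polynomialFunctions K).topologicalClosure with hA
  have : CompleteSpace A :=
    (Subalgebra.isClosed_topologicalClosure (polynomialFunctions K)).completeSpace_coe
  let x : A := ⟨(X : Polynomial ℂ).toContinuousMapOn K,
    Subalgebra.le_topologicalClosure _ ⟨X, by simp⟩⟩
  have hx : ∀ w : K, (x : C(K, ℂ)) w = w := fun w => by simp [x]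
  have hunit : ∀ ζ ∉ K, IsUnit (algebraMap ℂ A ζ - x) := fun ζ hζ =>
    isUnit_algebraMap_sub_of_hasLogOn hlog hζ x hx
  let ev : K → A →L[ℂ] ℂ := fun w =>
    (ContinuousMap.evalCLM ℂ w).comp (Subalgebra.toSubmodule A).subtypeL
  have hev : ∀ (w : K) (a : A), ev w a = (a : C(K, ℂ)) w := fun w a => rfl
  have hinv : ∀ ζ ∉ K, ∀ w : K, ev w (Ring.inverse (algebraMap ℂ A ζ - x)) = (ζ - w)⁻¹ := by
    intro ζ hζ w
    have h1 := Ring.mul_inverse_cancel _ (hunit ζ hζ)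
    have h2 := congrArg (fun a : A => (a : C(K, ℂ)) w) h1
    simp only [MulMemClass.coe_mul, ContinuousMap.mul_apply] at h2
    have h3 : ((algebraMap ℂ A ζ - x : A) : C(K, ℂ)) w = ζ - w := by
      simp [hx]
    rw [h3] at h2
    rw [hev]
    exact eq_inv_of_mul_eq_one_right (by simpa using h2)
  let F : ℝ → A := fun θ => (deriv (circleMap 0 ρ) θ * g (circleMap 0 ρ θ)) •
    Ring.inverse (algebraMap ℂ A (f (circleMap 0 ρ θ)) - x)
  have hcm : ∀ θ, circleMap 0 ρ θ ∈ sphere (0:ℂ) ρ := circleMap_mem_sphere 0 hρ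
  have hF : Continuous F := by
    have hc : Continuous (fun θ => deriv (circleMap 0 ρ) θ * g (circleMap 0 ρ θ)) := by
      refine Continuous.mul ?_ (hg.comp_continuous (continuous_circleMap 0 ρ) hcm)
      rw [show deriv (circleMap 0 ρ) = fun θ => circleMap 0 ρ θ * Complex.I from
        funext fun θ => deriv_circleMap 0 ρ θ]
      exact (continuous_circleMap 0 ρ).mul continuous_const
    have h1 : Continuous (fun θ => algebraMap ℂ A (f (circleMap 0 ρ θ)) - x) :=
      ((continuous_algebraMap ℂ A).comp
        (hf.comp_continuous (continuous_circleMap 0 ρ) hcm)).sub continuous_const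
    refine hc.smul (continuous_iff_continuousAt.2 fun θ => ?_)
    have hu := hunit _ (hfK _ (hcm θ))
    have h2 := NormedRing.inverse_continuousAt hu.unit
    rw [hu.unit_spec] at h2
    exact ContinuousAt.comp (f := fun θ => algebraMap ℂ A (f (circleMap 0 ρ θ)) - x)
      h2 h1.continuousAt
  set h : A := ∫ θ in 0..2 * Real.pi, F θ with hh
  have heval : ∀ w : K, (h : C(K, ℂ)) w = ∮ z in C(0, ρ), g z * (f z - w)⁻¹ := by
    intro w
    rw [← hev, hh, ← ContinuousLinearMap.intervalIntegral_comp_comm _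
      (hF.intervalIntegrable _ _), circleIntegral]
    refine intervalIntegral.integral_congr fun θ _ => ?_
    simp only [F, map_smul, hinv _ (hfK _ (hcm θ)) w, smul_eq_mul, mul_assoc]
  constructor
  · rw [continuousOn_iff_continuous_domRestrict]
    exact (h : C(K, ℂ)).continuous.congr heval
  · intro ε hε
    have hcl : (h : C(K, ℂ)) ∈ closure ((polynomialFunctions K : Subalgebra ℂ C(K, ℂ)) :
        Set C(K, ℂ)) := h.2
    obtain ⟨q, hq, hdist⟩ := Metric.mem_closure_iff.1 hcl ε hε
    rw [polynomialFunctions_coe] at hq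
    obtain ⟨p, rfl⟩ := hq
    refine ⟨p, fun w hw => ?_⟩
    have h1 := (ContinuousMap.dist_lt_iff hε).1 hdist ⟨w, hw⟩
    rw [heval, dist_comm, dist_eq_norm] at h1
    simpa using h1

theorem HasLogOn.union {u : ℂ → ℂ} {K L : Set ℂ} (hK : HasLogOn u K) (hL : HasLogOn u L)
    (hKc : IsClosed K) (hLc : IsClosed L) (hd : Disjoint K L) : HasLogOn u (K ∪ L) := by
  classical
  obtain ⟨g, hg, hgu⟩ := hK
  obtain ⟨h, hh, hhu⟩ := hL
  have hnot : ∀ z ∈ L, z ∉ K := fun z hz hzK => hd.le_bot ⟨hzK, hz⟩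
  refine ⟨fun z => if z ∈ K then g z else h z,
    ContinuousOn.union_of_isClosed (hg.congr fun z hz => if_pos hz)
      (hh.congr fun z hz => if_neg (hnot z hz)) hKc hLc, ?_⟩
  rintro z (hz | hz)
  · simpa only [if_pos hz] using hgu z hz
  · simpa only [if_neg (hnot z hz)] using hhu z hz

theorem hasLogOn_biUnion {ι : Type*} (s : Finset ι) {K : ι → Set ℂ} {u : ℂ → ℂ}
    (hc : ∀ i ∈ s, IsClosed (K i)) (hd : ∀ i ∈ s, ∀ k ∈ s, i ≠ k → Disjoint (K i) (K k))
    (hlog : ∀ i ∈ s, HasLogOn u (K i)) : HasLogOn u (⋃ i ∈ s, K i) := by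
  classical
  induction s using Finset.induction_on with
  | empty => exact ⟨0, by simp, by simp⟩
  | insert i s his ih =>
    rw [Finset.set_biUnion_insert]
    have hs : ∀ k ∈ s, k ∈ insert i s := fun k hk => Finset.mem_insert_of_mem hk
    refine (hlog i (Finset.mem_insert_self i s)).union
      (ih (fun k hk => hc k (hs k hk)) (fun k hk l hl => hd k (hs k hk) l (hs l hl))
        fun k hk => hlog k (hs k hk))
      (hc i (Finset.mem_insert_self i s))
      (s.finite_toSet.isClosed_biUnion fun k hk => hc k (hs k hk)) ?_
    simp only [Set.disjoint_iUnion_right]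
    intro k hk
    exact hd i (Finset.mem_insert_self i s) k (hs k hk) fun h => his (h ▸ hk)

/-- A logarithm of `f - w` along a circle, whose increment over one period is the contour integral
of the logarithmic derivative. -/
theorem exists_log_circleMap {f : ℂ → ℂ} {U : Set ℂ} (hU : IsOpen U)
    (hf : DifferentiableOn ℂ f U) {ρ : ℝ} (hρ : 0 ≤ ρ) (hsU : sphere (0:ℂ) ρ ⊆ U) {w : ℂ}
    (hw : ∀ z ∈ sphere (0:ℂ) ρ, f z ≠ w) :
    ∃ G : ℝ → ℂ, Continuous G ∧ (∀ t, Complex.exp (G t) = f (circleMap 0 ρ t) - w) ∧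
      ∀ t, G (t + 2 * Real.pi) = G t + ∮ z in C(0, ρ), deriv f z * (f z - w)⁻¹ := by
  have hcm : ∀ t, circleMap 0 ρ t ∈ sphere (0:ℂ) ρ := circleMap_mem_sphere 0 hρ
  have hne : ∀ t, f (circleMap 0 ρ t) - w ≠ 0 := fun t => sub_ne_zero.2 (hw _ (hcm t))
  have hfd : ∀ t, HasDerivAt (fun t => f (circleMap 0 ρ t) - w)
      (deriv f (circleMap 0 ρ t) * (circleMap 0 ρ t * Complex.I)) t := fun t =>
    (HasDerivAt.comp (𝕜 := ℝ) (𝕜' := ℂ) t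
      ((hf.differentiableAt (hU.mem_nhds (hsU (hcm t)))).hasDerivAt)
      (hasDerivAt_circleMap 0 ρ t)).sub_const w
  set q : ℝ → ℂ := fun t => deriv (circleMap 0 ρ) t •
    (deriv f (circleMap 0 ρ t) * (f (circleMap 0 ρ t) - w)⁻¹) with hq
  have hqc : Continuous q := by
    have hd : ContinuousOn (deriv f) (sphere (0:ℂ) ρ) := (hf.deriv hU).continuousOn.mono hsU
    have h1 : Continuous fun t => f (circleMap 0 ρ t) - w :=
      continuous_iff_continuousAt.2 fun t => (hfd t).continuousAt
    simp only [hq, deriv_circleMap]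
    exact ((continuous_circleMap 0 ρ).mul continuous_const).smul
      ((hd.comp_continuous (continuous_circleMap 0 ρ) hcm).mul (h1.inv₀ hne))
  have hqper : Function.Periodic q (2 * Real.pi) := fun t => by
    simp only [hq, deriv_circleMap, periodic_circleMap 0 ρ t]
  have hGd : ∀ t, HasDerivAt (fun t => Complex.log (f (circleMap 0 ρ 0) - w) + ∫ s in 0..t, q s)
      (q t) t := fun t => (hqc.integral_hasStrictDerivAt 0 t).hasDerivAt.const_add _
  refine ⟨fun t => Complex.log (f (circleMap 0 ρ 0) - w) + ∫ s in 0..t, q s,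
    continuous_iff_continuousAt.2 fun t => (hGd t).continuousAt, ?_, ?_⟩
  · intro t
    have hder : ∀ s, HasDerivAt (fun t => (f (circleMap 0 ρ t) - w) *
        Complex.exp (-(Complex.log (f (circleMap 0 ρ 0) - w) + ∫ s in 0..t, q s))) 0 s := by
      intro s
      refine ((hfd s).mul (hGd s).neg.cexp).congr_deriv ?_
      have := hne s
      simp only [hq, deriv_circleMap, smul_eq_mul, Pi.neg_apply]
      field_simp
      ring
    have hconst := is_const_of_deriv_eq_zero (fun s => (hder s).differentiableAt)
      (fun s => (hder s).deriv) t 0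
    simp only [intervalIntegral.integral_same, add_zero] at hconst
    rw [Complex.exp_neg, Complex.exp_neg, Complex.exp_log (hne 0),
      mul_inv_cancel₀ (hne 0)] at hconst
    exact ((mul_inv_eq_one₀ (Complex.exp_ne_zero _)).1 hconst).symm
  · intro t
    have h1 : (∮ z in C(0, ρ), deriv f z * (f z - w)⁻¹) = ∫ s in t..t + 2 * Real.pi, q s := by
      rw [hqper.intervalIntegral_add_eq t 0, zero_add]
      rfl
    rw [h1, add_assoc, intervalIntegral.integral_add_adjacent_intervals
      (hqc.intervalIntegrable _ _) (hqc.intervalIntegrable _ _)]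

theorem circleIntegral_eq_of_differentiableOn {H : ℂ → ℂ} {W : Set ℂ} (hW : IsOpen W)
    (hH : DifferentiableOn ℂ H W) {r R : ℝ} (hr : 0 < r) (hR : 0 < R)
    (hsub : ∀ z : ℂ, ‖z‖ ∈ uIcc r R → z ∈ W) :
    (∮ z in C(0, r), H z) = ∮ z in C(0, R), H z := by
  wlog hle : r ≤ R generalizing r R
  · exact (this hR hr (by rwa [uIcc_comm]) (le_of_not_ge hle)).symm
  rw [uIcc_of_le hle] at hsub
  refine (Complex.circleIntegral_eq_of_differentiable_on_annulus_off_countable hr hle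
    countable_empty (hH.continuousOn.mono fun z hz => hsub z ?_) fun z hz => ?_).symm
  · simpa [and_comm] using hz
  · refine hH.differentiableAt (hW.mem_nhds (hsub z ?_))
    have h1 : ‖z‖ < R ∧ r < ‖z‖ := by simpa using hz
    exact ⟨h1.2.le, h1.1.le⟩

theorem isPreconnected_annulus {s t : ℝ} (hs : 0 < s) (ht : 0 < t) :
    IsPreconnected {z : ℂ | s < ‖z‖ ∧ ‖z‖ < t} := by
  have himg : {z : ℂ | s < ‖z‖ ∧ ‖z‖ < t} =
      Complex.exp '' (Complex.reLm ⁻¹' Ioo (Real.log s) (Real.log t)) := by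
    ext z
    constructor
    · rintro ⟨h1, h2⟩
      have hz : z ≠ 0 := norm_pos_iff.1 (hs.trans h1)
      refine ⟨Complex.log z, ⟨?_, ?_⟩, Complex.exp_log hz⟩
      · simpa [Complex.log_re] using Real.log_lt_log hs h1
      · simpa [Complex.log_re] using Real.log_lt_log (hs.trans h1) h2
    · rintro ⟨y, ⟨h1, h2⟩, rfl⟩
      have h1' : Real.log s < y.re := h1
      have h2' : y.re < Real.log t := h2
      rw [mem_ofPred_eq, Complex.norm_exp]
      exact ⟨(Real.log_lt_iff_lt_exp hs).1 h1', (Real.lt_log_iff_exp_lt ht).1 h2'⟩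
  rw [himg]
  exact ((convex_Ioo _ _).linear_preimage _).isPreconnected.image _
    Complex.continuous_exp.continuousOn

/-- The parametrization of an analytic boundary curve maps a one-sided neighbourhood of the unit
circle outside the domain. -/
theorem exists_circle_outside {D U : Set ℂ} (hDo : IsOpen D) (hDb : Bornology.IsBounded D)
    (hDne : D.Nonempty) {f : ℂ → ℂ} (hU : IsOpen U) (hsU : sphere (0:ℂ) 1 ⊆ U)
    (hf : DifferentiableOn ℂ f U) (hinj : InjOn f U) (hfr : frontier D = f '' sphere (0:ℂ) 1) :
    ∃ ρ : ℝ, 0 < ρ ∧ (∀ z : ℂ, ‖z‖ ∈ uIcc 1 ρ → z ∈ U ∧ f z ∉ D) ∧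
      ∀ z ∈ sphere (0:ℂ) ρ, f z ∉ closure D := by
  obtain ⟨δ, hδ, hthick⟩ := (isCompact_sphere (0:ℂ) 1).exists_thickening_subset_open hU hsU
  obtain ⟨ε, hε, hε2, hεδ⟩ : ∃ ε : ℝ, 0 < ε ∧ ε < 1 ∧ ε ≤ δ :=
    ⟨min δ (1 / 2), by positivity, lt_of_le_of_lt (min_le_right _ _) (by norm_num), min_le_left _ _⟩
  have hann : ∀ z : ℂ, 1 - ε < ‖z‖ → ‖z‖ < 1 + ε → z ∈ U := by
    intro z h1 h2
    have hz : 0 < ‖z‖ := by linarith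
    refine hthick (mem_thickening_iff.2 ⟨z / ‖z‖, ?_, ?_⟩)
    · rw [mem_sphere_zero_iff_norm, norm_div, Complex.norm_real, norm_norm, div_self hz.ne']
    · have hz' : (‖z‖ : ℂ) ≠ 0 := by exact_mod_cast hz.ne'
      have : z - z / ‖z‖ = z / ‖z‖ * ((‖z‖ - 1 : ℝ) : ℂ) := by
        push_cast
        field_simp
      rw [dist_eq_norm, this, norm_mul, norm_div, Complex.norm_real, Complex.norm_real, norm_norm,
        div_self hz.ne', one_mul, Real.norm_eq_abs, abs_lt]
      constructor <;> linarith
  have hside : ∀ s t : ℝ, 1 - ε ≤ s → t ≤ 1 + ε → 0 < t → (t ≤ 1 ∨ 1 ≤ s) →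
      f '' {z : ℂ | s < ‖z‖ ∧ ‖z‖ < t} ⊆ D ∨ f '' {z : ℂ | s < ‖z‖ ∧ ‖z‖ < t} ⊆ (closure D)ᶜ := by
    intro s t hs ht ht0 hst
    have hsub : {z : ℂ | s < ‖z‖ ∧ ‖z‖ < t} ⊆ U := fun z hz =>
      hann z (by linarith [hz.1]) (by linarith [hz.2])
    refine IsPreconnected.subset_or_subset hDo isClosed_closure.isOpen_compl
      (Set.disjoint_left.2 fun x hx hx' => hx' (subset_closure hx)) ?_
      ((isPreconnected_annulus (by linarith) ht0).image _ (hf.continuousOn.mono hsub))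
    rintro _ ⟨z, hz, rfl⟩
    by_contra hcon
    rw [mem_union, not_or, mem_compl_iff, not_not] at hcon
    have hmem : f z ∈ frontier D := ⟨hcon.2, by rw [hDo.interior_eq]; exact hcon.1⟩
    rw [hfr] at hmem
    obtain ⟨y, hy, hyz⟩ := hmem
    have hyz' : y = z := hinj (hsU hy) (hsub hz) hyz
    rw [mem_sphere_zero_iff_norm, hyz'] at hy
    rcases hst with h | h
    · linarith [hz.2]
    · linarith [hz.1]
  have hfin : ∀ ρ : ℝ, 0 < ρ → 1 - ε < ρ → ρ < 1 + ε → ρ ≠ 1 →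
      (∀ z : ℂ, ‖z‖ ∈ uIcc 1 ρ → ‖z‖ ≠ 1 → f z ∉ closure D) →
      ∃ ρ : ℝ, 0 < ρ ∧ (∀ z : ℂ, ‖z‖ ∈ uIcc 1 ρ → z ∈ U ∧ f z ∉ D) ∧
        ∀ z ∈ sphere (0:ℂ) ρ, f z ∉ closure D := by
    intro ρ hρ h1 h2 hne hout
    refine ⟨ρ, hρ, fun z hz => ⟨?_, ?_⟩, fun z hz => ?_⟩
    · obtain ⟨h3, h4⟩ := hz
      refine hann z (lt_of_lt_of_le ?_ h3) (lt_of_le_of_lt h4 ?_)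
      · exact lt_min (by linarith) h1
      · exact max_lt (by linarith) h2
    · by_cases hz1 : ‖z‖ = 1
      · have : f z ∈ frontier D := hfr ▸ ⟨z, mem_sphere_zero_iff_norm.2 hz1, rfl⟩
        exact fun h => this.2 (by rwa [hDo.interior_eq])
      · exact fun h => hout z hz hz1 (subset_closure h)
    · rw [mem_sphere_zero_iff_norm] at hz
      exact hout z (hz ▸ right_mem_uIcc) (hz ▸ hne)
  rcases hside 1 (1 + ε) (by linarith) le_rfl (by linarith) (Or.inr le_rfl) with hp | hp
  · rcases hside (1 - ε) 1 le_rfl (by linarith) one_pos (Or.inl le_rfl) with hm | hm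
    · exfalso
      have hAU : {z : ℂ | 1 - ε < ‖z‖ ∧ ‖z‖ < 1 + ε} ⊆ U := fun z hz => hann z hz.1 hz.2
      have hAo : IsOpen {z : ℂ | 1 - ε < ‖z‖ ∧ ‖z‖ < 1 + ε} :=
        (isOpen_lt continuous_const continuous_norm).inter
          (isOpen_lt continuous_norm continuous_const)
      have hsA : sphere (0:ℂ) 1 ⊆ {z : ℂ | 1 - ε < ‖z‖ ∧ ‖z‖ < 1 + ε} := fun z hz => by
        rw [mem_sphere_zero_iff_norm] at hz
        constructor <;> rw [hz] <;> linarith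
      have hopen : IsOpen (f '' {z : ℂ | 1 - ε < ‖z‖ ∧ ‖z‖ < 1 + ε}) := by
        have han : AnalyticOnNhd ℂ f {z : ℂ | 1 - ε < ‖z‖ ∧ ‖z‖ < 1 + ε} :=
          (hf.mono hAU).analyticOnNhd hAo
        rcases han.is_constant_or_isOpen (isPreconnected_annulus (by linarith) (by linarith))
          with ⟨w, hw⟩ | h
        · exfalso
          have m1 : (1:ℂ) ∈ sphere (0:ℂ) 1 := by simp
          have m2 : (-1:ℂ) ∈ sphere (0:ℂ) 1 := by simp
          have := hinj (hsU m1) (hsU m2) ((hw _ (hsA m1)).trans (hw _ (hsA m2)).symm)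
          norm_num at this
        · exact h _ subset_rfl hAo
      have hsubcl : f '' {z : ℂ | 1 - ε < ‖z‖ ∧ ‖z‖ < 1 + ε} ⊆ closure D := by
        rintro _ ⟨z, hz, rfl⟩
        rcases lt_trichotomy ‖z‖ 1 with h | h | h
        · exact subset_closure (hm ⟨z, ⟨hz.1, h⟩, rfl⟩)
        · exact frontier_subset_closure
            (hfr ▸ ⟨z, mem_sphere_zero_iff_norm.2 h, rfl⟩ : f z ∈ frontier D)
        · exact subset_closure (hp ⟨z, ⟨h, hz.2⟩, rfl⟩)
      have hcl : closure D = D ∪ f '' {z : ℂ | 1 - ε < ‖z‖ ∧ ‖z‖ < 1 + ε} := by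
        refine subset_antisymm ?_ (union_subset subset_closure hsubcl)
        rw [closure_eq_self_union_frontier, hfr]
        exact union_subset_union_right _ (image_mono hsA)
      have hclopen : IsClopen (closure D) := ⟨isClosed_closure, hcl ▸ hDo.union hopen⟩
      rcases isClopen_iff.1 hclopen with h | h
      · exact hDne.closure.ne_empty h
      · exact NormedSpace.unbounded_univ ℂ ℂ (h ▸ hDb.closure)
    · refine hfin (1 - ε / 2) (by linarith) (by linarith) (by linarith) (by linarith)
        fun z hz hz1 => hm ⟨z, ⟨?_, ?_⟩, rfl⟩
      · rw [uIcc_of_ge (by linarith)] at hz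
        linarith [hz.1]
      · rw [uIcc_of_ge (by linarith)] at hz
        exact lt_of_le_of_ne hz.2 hz1
  · refine hfin (1 + ε / 2) (by linarith) (by linarith) (by linarith) (by linarith)
      fun z hz hz1 => hp ⟨z, ⟨?_, ?_⟩, rfl⟩
    · rw [uIcc_of_le (by linarith)] at hz
      exact lt_of_le_of_ne hz.1 (Ne.symm hz1)
    · rw [uIcc_of_le (by linarith)] at hz
      linarith [hz.2]

/-- A domain with analytic boundary can be separated by polynomials from a disjoint compact set,
provided neither set has holes. -/
theorem exists_polynomial_separating {D L : Set ℂ} (hDo : IsOpen D)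
    (hDb : Bornology.IsBounded D) (hDc : IsConnected D)
    (hΓ : IsAnalyticJordanCurve (frontier D)) (hL : IsCompact L)
    (hdisj : Disjoint (closure D) L) (hDlog : ∀ w ∉ closure D, HasLogOn (fun z => z - w) (closure D))
    (hLlog : ∀ w ∉ L, HasLogOn (fun z => z - w) L) {δ : ℝ} (hδ : 0 < δ) :
    ∃ p : Polynomial ℂ, (∀ w ∈ closure D, ‖p.eval w - 1‖ < δ) ∧ ∀ w ∈ L, ‖p.eval w‖ < δ := by
  obtain ⟨U₀, f, hU₀, hsU₀, hf₀, hinj₀, hfr⟩ := hΓ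
  set U := U₀ ∩ f ⁻¹' Lᶜ with hUdef
  have hU : IsOpen U := hf₀.continuousOn.isOpen_inter_preimage hU₀ hL.isClosed.isOpen_compl
  have hsU : sphere (0:ℂ) 1 ⊆ U := fun z hz => ⟨hsU₀ hz, fun h => hdisj.le_bot
    ⟨frontier_subset_closure (hfr ▸ ⟨z, hz, rfl⟩ : f z ∈ frontier D), h⟩⟩
  have hf : DifferentiableOn ℂ f U := hf₀.mono inter_subset_left
  have hinj : InjOn f U := hinj₀.mono inter_subset_left
  obtain ⟨ρ, hρ, hbetween, hout⟩ := exists_circle_outside hDo hDb hDc.nonempty hU hsU hf hinj hfr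
  have hsρ : ∀ z ∈ sphere (0:ℂ) ρ, z ∈ U := fun z hz =>
    (hbetween z (mem_sphere_zero_iff_norm.1 hz ▸ right_mem_uIcc)).1
  have hKc : IsCompact (closure D ∪ L) := hDb.isCompact_closure.union hL
  have hKlog : ∀ w ∉ closure D ∪ L, HasLogOn (fun z => z - w) (closure D ∪ L) := fun w hw => by
    rw [mem_union, not_or] at hw
    exact (hDlog w hw.1).union (hLlog w hw.2) isClosed_closure hL.isClosed hdisj
  have hfK : ∀ z ∈ sphere (0:ℂ) ρ, f z ∉ closure D ∪ L := fun z hz h =>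
    h.elim (hout z hz) (hsρ z hz).2
  obtain ⟨hcont, happ⟩ := continuousOn_and_exists_polynomial_of_circleIntegral hKc hKlog hρ.le
    (hf.continuousOn.mono hsρ) ((hf.deriv hU).continuousOn.mono hsρ) hfK
  set I : ℝ → ℂ → ℂ := fun r w => ∮ z in C(0, r), deriv f z * (f z - w)⁻¹ with hI
  have hIeq : ∀ w, w ∈ D ∪ L → I 1 w = I ρ w := by
    intro w hw
    have hWo : IsOpen (U ∩ f ⁻¹' {w}ᶜ) :=
      hf.continuousOn.isOpen_inter_preimage hU isOpen_compl_singleton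
    refine circleIntegral_eq_of_differentiableOn hWo ?_ one_pos hρ fun z hz => ?_
    · refine DifferentiableOn.mul ((hf.deriv hU).mono inter_subset_left) ?_
      exact ((hf.mono inter_subset_left).sub_const w).inv fun z hz => sub_ne_zero.2 hz.2
    · obtain ⟨h1, h2⟩ := hbetween z hz
      refine ⟨h1, fun h => ?_⟩
      rw [mem_singleton_iff] at h
      rcases hw with hw | hw
      · exact h2 (h ▸ hw)
      · exact h1.2 (h ▸ hw)
  have hexp : ∀ t : ℝ, circleMap 0 1 t = Complex.exp (t * Complex.I) := fun t => by
    simp [circleMap]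
  have hfc : ContinuousOn f (sphere (0:ℂ) 1) := hf.continuousOn.mono hsU
  have hIL : ∀ w ∈ L, I ρ w = 0 := by
    intro w hw
    have hwD : w ∉ closure D := fun h => hdisj.le_bot ⟨h, hw⟩
    obtain ⟨g, hg, hgw⟩ := hDlog w hwD
    have hmem : ∀ t : ℝ, f (Complex.exp (t * Complex.I)) ∈ closure D := fun t =>
      frontier_subset_closure (hfr ▸ ⟨_, exp_ofReal_mul_I_mem_sphere t, rfl⟩ : _ ∈ frontier D)
    obtain ⟨G, hG, hGe, hGp⟩ := exists_log_circleMap hU hf zero_le_one hsU (w := w)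
      fun z hz h => (hsU hz).2 (h ▸ hw)
    have hgc : Continuous fun t : ℝ => g (f (Complex.exp (t * Complex.I))) :=
      hg.comp_continuous (hfc.comp_continuous (by fun_prop) exp_ofReal_mul_I_mem_sphere) hmem
    have h1 := sub_eq_sub_of_exp_eq hG hgc
      (fun t => by rw [hGe, hexp, hgw _ (hmem t)]) (0 + 2 * Real.pi) 0
    have e1 : Complex.exp ((0 + 2 * Real.pi : ℝ) * Complex.I) = 1 := by
      push_cast; rw [zero_add]; exact Complex.exp_two_pi_mul_I
    have e0 : Complex.exp ((0 : ℝ) * Complex.I) = 1 := by simp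
    rw [e1, e0, hGp] at h1
    rw [← hIeq w (Or.inr hw)]
    linear_combination h1
  obtain ⟨a, ha⟩ := hDc.nonempty
  have hIa : I ρ a ≠ 0 := by
    rw [← hIeq a (Or.inl ha)]
    intro h0
    obtain ⟨G, hG, hGe, hGp⟩ := exists_log_circleMap hU hf zero_le_one hsU (w := a)
      fun z hz h => (hbetween z (mem_sphere_zero_iff_norm.1 hz ▸ left_mem_uIcc)).2 (h ▸ ha)
    have hlog := hasLogOn_of_periodic (u := fun z => z - a) hfc (hinj.mono hsU) hG
      (fun t => by rw [hGp]; exact (congrArg _ h0).trans (add_zero _))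
      (fun t => by rw [hGe, hexp])
    rw [← hfr] at hlog
    exact one_ne_zero (eq_zero_of_hasLogOn_frontier hDo hDb ha (p := 1) (v := fun _ => 1)
      continuousOn_const (fun _ _ => one_ne_zero) (by simpa using hlog))
  have hIint : ∀ w ∈ closure D, ∃ n : ℤ, I ρ w = n * (2 * Real.pi * Complex.I) := by
    intro w hw
    obtain ⟨G, hG, hGe, hGp⟩ := exists_log_circleMap hU hf hρ.le hsρ (w := w)
      fun z hz h => hout z hz (h ▸ hw)
    have h1 : Complex.exp (G (0 + 2 * Real.pi)) = Complex.exp (G 0) := by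
      rw [hGe, hGe, periodic_circleMap 0 ρ 0]
    obtain ⟨n, hn⟩ := Complex.exp_eq_exp_iff_exists_int.1 h1
    exact ⟨n, by linear_combination hn - hGp 0⟩
  have hIconst : ∀ w ∈ closure D, I ρ w = I ρ a := by
    have hpi : (2 * Real.pi * Complex.I : ℂ) ≠ 0 := Complex.two_pi_I_ne_zero
    have hdisc : IsDiscrete (range ((↑) : ℤ → ℂ)) := by
      exact Complex.isClosedEmbedding_intCast.isInducing.isDiscrete_range
    intro w hw
    have hq : ContinuousOn (fun w => I ρ w / (2 * Real.pi * Complex.I)) (closure D) :=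
      (hcont.mono subset_union_left).div_const _
    have := hDc.isPreconnected.closure.constant_of_mapsTo hdisc hq (fun w hw => by
      obtain ⟨n, hn⟩ := hIint w hw
      exact ⟨n, by simp only [hn]; field_simp⟩) hw (subset_closure ha)
    exact (div_left_inj' hpi).1 this
  obtain ⟨p, hp⟩ := happ (δ * ‖I ρ a‖) (mul_pos hδ (norm_pos_iff.2 hIa))
  have hscale : ∀ x : ℂ, ‖x‖ < δ * ‖I ρ a‖ → ‖(I ρ a)⁻¹ * x‖ < δ := fun x hx => by
    rw [norm_mul, norm_inv, inv_mul_lt_iff₀ (norm_pos_iff.2 hIa), mul_comm]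
    exact hx
  refine ⟨Polynomial.C (I ρ a)⁻¹ * p, fun w hw => ?_, fun w hw => ?_⟩
  · have h1 := hscale _ (hp w (Or.inl hw))
    have h2 : (∮ z in C(0, ρ), deriv f z * (f z - w)⁻¹) = I ρ a := hIconst w hw
    rwa [h2, mul_sub, inv_mul_cancel₀ hIa, ← Polynomial.eval_C_mul] at h1
  · have h1 := hscale _ (hp w (Or.inr hw))
    have h2 : (∮ z in C(0, ρ), deriv f z * (f z - w)⁻¹) = 0 := hIL w hw
    rwa [h2, sub_zero, ← Polynomial.eval_C_mul] at h1

/-- Polynomial expressions are integrable over bounded sets. -/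
theorem Continuous.integrableOn_of_isBounded {E : Type*} [NormedAddCommGroup E]
    {f : ℂ → E} (hf : Continuous f) {G : Set ℂ} (hG : Bornology.IsBounded G) :
    IntegrableOn f G :=
  (hf.continuousOn.integrableOn_compact hG.isCompact_closure).mono_set subset_closure

/-- Pythagoras for orthogonal polynomials in `L²(G)`. -/
theorem setIntegral_norm_sq_sum_of_orthogonal {G : Set ℂ} (hG : Bornology.IsBounded G)
    {Q : ℕ → Polynomial ℂ} {w : ℕ → ℝ}
    (horth : ∀ n k, (∫ z in G, (Q n).eval z * (starRingEnd ℂ) ((Q k).eval z)) =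
      if n = k then (w n : ℂ) else 0) (c : ℕ → ℂ) (s : Finset ℕ) :
    ∫ z in G, ‖∑ k ∈ s, c k * (Q k).eval z‖ ^ 2 = ∑ k ∈ s, ‖c k‖ ^ 2 * w k := by
  have hint : ∀ n k, IntegrableOn (fun z => c n * (starRingEnd ℂ) (c k) *
      ((Q n).eval z * (starRingEnd ℂ) ((Q k).eval z))) G := fun n k =>
    Continuous.integrableOn_of_isBounded (by fun_prop) hG
  apply Complex.ofReal_injective
  rw [← integral_complex_ofReal]
  have h1 : ∀ z, ((‖∑ k ∈ s, c k * (Q k).eval z‖ ^ 2 : ℝ) : ℂ) =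
      ∑ n ∈ s, ∑ k ∈ s, c n * (starRingEnd ℂ) (c k) *
        ((Q n).eval z * (starRingEnd ℂ) ((Q k).eval z)) := fun z => by
    rw [Complex.ofReal_pow, ← Complex.mul_conj', map_sum, Finset.sum_mul_sum]
    refine Finset.sum_congr rfl fun n _ => Finset.sum_congr rfl fun k _ => ?_
    rw [map_mul]
    ring
  simp only [h1]
  rw [integral_finsetSum _ fun n _ => integrable_finsetSum _ fun k _ => hint n k]
  push_cast
  refine Finset.sum_congr rfl fun n hn => ?_
  rw [integral_finsetSum _ fun k _ => hint n k]
  simp only [integral_const_mul, horth]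
  simp only [mul_ite, mul_zero, Finset.sum_ite_eq, hn, if_true, Complex.mul_conj']

/-- The reproducing-kernel bound for point evaluation on the span of orthogonal polynomials. -/
theorem norm_sq_sum_le_of_orthogonal {G : Set ℂ} (hG : Bornology.IsBounded G)
    {Q : ℕ → Polynomial ℂ} {w : ℕ → ℝ} (hw : ∀ k, 0 < w k)
    (horth : ∀ n k, (∫ z in G, (Q n).eval z * (starRingEnd ℂ) ((Q k).eval z)) =
      if n = k then (w n : ℂ) else 0) (c : ℕ → ℂ) (s : Finset ℕ) (z : ℂ) :
    ‖∑ k ∈ s, c k * (Q k).eval z‖ ^ 2 ≤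
      (∫ z in G, ‖∑ k ∈ s, c k * (Q k).eval z‖ ^ 2) * ∑ k ∈ s, ‖(Q k).eval z‖ ^ 2 / w k := by
  rw [setIntegral_norm_sq_sum_of_orthogonal hG horth]
  calc ‖∑ k ∈ s, c k * (Q k).eval z‖ ^ 2
      ≤ (∑ k ∈ s, ‖c k * (Q k).eval z‖) ^ 2 := by gcongr; exact norm_sum_le _ _
    _ ≤ _ := by
      refine Finset.sum_sq_le_sum_mul_sum_of_sq_le_mul s
        (fun k _ => mul_nonneg (sq_nonneg _) (hw k).le)
        (fun k _ => div_nonneg (sq_nonneg _) (hw k).le) fun k _ => ?_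
      have := (hw k).ne'
      rw [norm_mul]
      field_simp
      rfl

/-- A sequence of polynomials of degrees `0, 1, 2, …` spans all polynomials. -/
theorem exists_eq_sum_of_natDegree_eq {P : ℕ → Polynomial ℂ} (hP : ∀ n, (P n).natDegree = n)
    (hP0 : ∀ n, P n ≠ 0) (M : ℕ) :
    ∀ p : Polynomial ℂ, p.degree < M → ∃ c : ℕ → ℂ,
      ∀ z, p.eval z = ∑ k ∈ Finset.range M, c k * (P k).eval z := by
  induction M with
  | zero =>
    intro p hp
    have : p = 0 := by simpa using hp
    exact ⟨0, fun z => by simp [this]⟩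
  | succ M ih =>
    intro p hp
    set t := p.coeff M / (P M).coeff M with ht
    have hlc : (P M).coeff M ≠ 0 := by
      have := leadingCoeff_ne_zero.2 (hP0 M)
      rwa [leadingCoeff, hP M] at this
    obtain ⟨c, hc⟩ := ih (p - Polynomial.C t * P M) (by
      rw [degree_lt_iff_coeff_zero] at hp ⊢
      intro m hm
      rw [coeff_sub, coeff_C_mul]
      rcases hm.eq_or_lt with rfl | hm
      · rw [ht, div_mul_cancel₀ _ hlc, sub_self]
      · rw [hp m hm, coeff_eq_zero_of_natDegree_lt (by rwa [hP M]), mul_zero, sub_zero])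
    refine ⟨Function.update c M t, fun z => ?_⟩
    rw [Finset.sum_range_succ, Function.update_self, Finset.sum_congr rfl
      (g := fun k => c k * (P k).eval z) fun k hk => by
        rw [Function.update_of_ne (Finset.mem_range.1 hk).ne], ← hc z]
    simp

theorem IsBergmanSystem.ne_zero {G : Set ℂ} {P : ℕ → Polynomial ℂ} {lam : ℕ → ℝ}
    (h : IsBergmanSystem G P lam) (n : ℕ) : P n ≠ 0 := by
  rw [← leadingCoeff_ne_zero, (h.2.1 n).2]
  exact_mod_cast (h.2.1 n).1.ne'

/-- The Christoffel function bound: point evaluations of polynomials of degree at most `M` are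
controlled by the diagonal of the Bergman kernel. -/
theorem IsBergmanSystem.norm_sq_eval_le {G : Set ℂ} {P : ℕ → Polynomial ℂ} {lam : ℕ → ℝ}
    (h : IsBergmanSystem G P lam) (hG : Bornology.IsBounded G) {M : ℕ} {p : Polynomial ℂ}
    (hp : p.natDegree ≤ M) (z : ℂ) :
    ‖p.eval z‖ ^ 2 ≤
      (∫ w in G, ‖p.eval w‖ ^ 2) * ∑ k ∈ Finset.range (M + 1), ‖(P k).eval z‖ ^ 2 := by
  obtain ⟨c, hc⟩ := exists_eq_sum_of_natDegree_eq h.1 h.ne_zero (M + 1) p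
    (degree_lt_iff_coeff_zero _ _ |>.2 fun m hm => coeff_eq_zero_of_natDegree_lt (by omega))
  have := norm_sq_sum_le_of_orthogonal hG (w := fun _ => 1) (fun _ => one_pos)
    (by simpa using h.2.2) c (Finset.range (M + 1)) z
  simpa only [hc, div_one] using this

/-- The reproducing kernel `∑ conj (P k z) P k`, as a polynomial in the other variable. -/
theorem IsBergmanSystem.exists_kernel {G : Set ℂ} {P : ℕ → Polynomial ℂ} {lam : ℕ → ℝ}
    (h : IsBergmanSystem G P lam) (hG : Bornology.IsBounded G) (n : ℕ) (z : ℂ) :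
    ∃ q : Polynomial ℂ, q.natDegree ≤ n ∧
      ‖q.eval z‖ = ∑ k ∈ Finset.range (n + 1), ‖(P k).eval z‖ ^ 2 ∧
      ∫ w in G, ‖q.eval w‖ ^ 2 = ∑ k ∈ Finset.range (n + 1), ‖(P k).eval z‖ ^ 2 := by
  have heval : ∀ w, (∑ k ∈ Finset.range (n + 1),
      Polynomial.C ((starRingEnd ℂ) ((P k).eval z)) * P k).eval w =
      ∑ k ∈ Finset.range (n + 1), (starRingEnd ℂ) ((P k).eval z) * (P k).eval w := fun w => by
    simp [eval_finsetSum]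
  refine ⟨∑ k ∈ Finset.range (n + 1), Polynomial.C ((starRingEnd ℂ) ((P k).eval z)) * P k,
    natDegree_sum_le_of_forall_le _ _ fun k hk => (natDegree_C_mul_le _ _).trans ?_, ?_, ?_⟩
  · rw [h.1 k]
    exact Nat.lt_succ_iff.1 (Finset.mem_range.1 hk)
  · rw [heval]
    simp only [Complex.conj_mul']
    rw [← Complex.norm_of_nonneg (r := ∑ k ∈ Finset.range (n + 1), ‖(P k).eval z‖ ^ 2)
      (Finset.sum_nonneg fun _ _ => sq_nonneg _)]
    push_cast
    rfl
  · simp only [heval]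
    rw [setIntegral_norm_sq_sum_of_orthogonal hG (w := fun _ => 1) (by simpa using h.2.2)]
    simp

/-- The monomials are orthogonal on discs centred at the origin. -/
theorem setIntegral_ball_pow_mul_conj_pow (ρ : ℝ) (n k : ℕ) :
    (∫ z in ball (0:ℂ) ρ, ((X : Polynomial ℂ) ^ n).eval z *
        (starRingEnd ℂ) (((X : Polynomial ℂ) ^ k).eval z)) =
      if n = k then ((∫ z in ball (0:ℂ) ρ, ‖z‖ ^ (2 * n) : ℝ) : ℂ) else 0 := by
  simp only [eval_pow, eval_X, map_pow]
  split_ifs with hnk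
  · subst hnk
    rw [← integral_complex_ofReal]
    refine integral_congr_ae (ae_of_all _ fun z => ?_)
    simp only
    rw [← mul_pow, Complex.mul_conj', ← pow_mul]
    push_cast
    rfl
  · have hrot : ∀ u : Circle, (∫ z in ball (0:ℂ) ρ, z ^ n * (starRingEnd ℂ) z ^ k) =
        ((u:ℂ) ^ n * (starRingEnd ℂ) (u:ℂ) ^ k) *
          ∫ z in ball (0:ℂ) ρ, z ^ n * (starRingEnd ℂ) z ^ k := fun u => by
      have hm := (rotation u).measurePreserving
      have he : MeasurableEmbedding (rotation u) :=
        (rotation u).toHomeomorph.measurableEmbedding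
      rw [← integral_const_mul]
      conv_lhs => rw [← hm.setIntegral_preimage_emb he]
      have hpre : rotation u ⁻¹' ball (0:ℂ) ρ = ball 0 ρ := by
        ext z
        rw [mem_preimage, mem_ball_zero_iff, mem_ball_zero_iff, LinearIsometryEquiv.norm_map]
      rw [hpre]
      refine integral_congr_ae (ae_of_all _ fun z => ?_)
      simp only [rotation_apply, map_mul]
      ring
    set J := ∫ z in ball (0:ℂ) ρ, z ^ n * (starRingEnd ℂ) z ^ k
    by_contra hJ
    have h1 := hrot (Circle.exp 1)
    have h2 : ((Circle.exp 1 : Circle) : ℂ) ^ n *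
        (starRingEnd ℂ) ((Circle.exp 1 : Circle) : ℂ) ^ k = 1 :=
      (mul_eq_right₀ hJ).1 h1.symm
    rw [Circle.coe_exp, ← Complex.exp_conj, ← Complex.exp_nat_mul, ← Complex.exp_nat_mul,
      ← Complex.exp_add, Complex.exp_eq_one_iff] at h2
    obtain ⟨i, hi⟩ := h2
    have h3 := congrArg Complex.im hi
    simp at h3
    have hne : ((n:ℤ) - k : ℤ) ≠ 0 := by omega
    have hi0 : i ≠ 0 := by
      rintro rfl
      apply hne
      have : ((n:ℝ) - k) = 0 := by simpa [sub_eq_add_neg] using h3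
      exact_mod_cast this
    refine irrational_pi.ne_rat (((n:ℤ) - k : ℤ) / (2 * i) : ℚ) ?_
    push_cast
    have : (i:ℝ) ≠ 0 := by exact_mod_cast hi0
    field_simp
    linarith

theorem mul_pow_le_setIntegral_ball_norm_pow {ρ : ℝ} (hρ : 0 < ρ) :
    ∃ κ : ℝ, 0 < κ ∧ ∀ k : ℕ, κ * (ρ / 2) ^ (2 * k) ≤ ∫ z in ball (0:ℂ) ρ, ‖z‖ ^ (2 * k) := by
  set b : ℂ := ((3 * ρ / 4 : ℝ) : ℂ) with hb
  have hbn : ‖b‖ = 3 * ρ / 4 := by rw [hb, Complex.norm_of_nonneg (by positivity)]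
  have hfin : volume (ball b (ρ / 4)) ≠ ⊤ := measure_ball_lt_top.ne
  refine ⟨volume.real (ball b (ρ / 4)), ENNReal.toReal_pos
    (measure_ball_pos volume b (by positivity)).ne' hfin, fun k => ?_⟩
  have hint : IntegrableOn (fun z : ℂ => ‖z‖ ^ (2 * k)) (ball (0:ℂ) ρ) :=
    Continuous.integrableOn_of_isBounded (by fun_prop) isBounded_ball
  have hsub : ball b (ρ / 4) ⊆ ball 0 ρ := ball_subset_ball' (by
    rw [dist_zero_right, hbn]; linarith)
  refine le_trans ?_ (setIntegral_mono_set hint (ae_of_all _ fun z => by positivity)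
    hsub.eventuallyLE)
  rw [mul_comm]
  refine setIntegral_ge_of_const_le_real measurableSet_ball hfin (fun z hz => ?_)
    (hint.mono_set hsub)
  have h1 : dist z b < ρ / 4 := hz
  have h2 : ‖b‖ - ‖b - z‖ ≤ ‖z‖ := by linarith [norm_sub_norm_le b z]
  rw [dist_comm, dist_eq_norm] at h1
  gcongr
  linarith

/-- A Bernstein–Walsh type bound: on bounded sets, polynomials of degree at most `n` are
dominated by their `L²` norm on a fixed open set up to an exponential factor. -/
theorem exists_norm_sq_eval_le_of_isOpen {D B : Set ℂ} (hDo : IsOpen D)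
    (hDb : Bornology.IsBounded D) (hDne : D.Nonempty) (hB : Bornology.IsBounded B) :
    ∃ C R : ℝ, 0 < C ∧ 1 ≤ R ∧ ∀ (n : ℕ) (q : Polynomial ℂ), q.natDegree ≤ n → ∀ z ∈ B,
      ‖q.eval z‖ ^ 2 ≤ C * R ^ n * ∫ w in D, ‖q.eval w‖ ^ 2 := by
  obtain ⟨a, ha⟩ := hDne
  obtain ⟨ρ, hρ, hball⟩ := Metric.isOpen_iff.1 hDo a ha
  obtain ⟨κ, hκ, hκle⟩ := mul_pow_le_setIntegral_ball_norm_pow hρ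
  obtain ⟨M, hM⟩ := hB.subset_closedBall a
  set T : ℝ := max 1 (2 * M / ρ) with hT
  have hT1 : 1 ≤ T := le_max_left _ _
  have hw : ∀ k : ℕ, 0 < ∫ z in ball (0:ℂ) ρ, ‖z‖ ^ (2 * k) := fun k =>
    lt_of_lt_of_le (by positivity) (hκle k)
  refine ⟨κ⁻¹, 2 * T ^ 2, by positivity, by nlinarith, fun n q hq z hz => ?_⟩
  set r := q.comp (X + Polynomial.C a) with hr
  have hreval : ∀ w, r.eval w = q.eval (w + a) := fun w => by simp [hr, eval_comp]
  have hrdeg : r.natDegree ≤ n := by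
    rw [hr, natDegree_comp]; simpa using hq
  have hrsum : ∀ w, r.eval w = ∑ k ∈ Finset.range (n + 1),
      r.coeff k * ((X : Polynomial ℂ) ^ k).eval w := fun w => by
    rw [eval_eq_sum_range' (Nat.lt_succ_of_le hrdeg)]; simp
  have hI : ∫ w in ball (0:ℂ) ρ, ‖r.eval w‖ ^ 2 ≤ ∫ w in D, ‖q.eval w‖ ^ 2 := by
    have hpre : (fun w : ℂ => w + a) ⁻¹' ball a ρ = ball 0 ρ := by
      ext w; simp [dist_eq_norm]
    simp only [hreval]
    rw [← hpre, (measurePreserving_add_right volume a).setIntegral_preimage_emb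
      (measurableEmbedding_addRight a) (fun w => ‖q.eval w‖ ^ 2)]
    exact setIntegral_mono_set (Continuous.integrableOn_of_isBounded (by fun_prop) hDb)
      (ae_of_all _ fun z => by positivity) hball.eventuallyLE
  have hI0 : 0 ≤ ∫ w in D, ‖q.eval w‖ ^ 2 := integral_nonneg fun _ => by positivity
  have hza : ‖z - a‖ ≤ M := by simpa [dist_eq_norm] using hM hz
  have hterm : ∀ k ∈ Finset.range (n + 1), ‖((X : Polynomial ℂ) ^ k).eval (z - a)‖ ^ 2 /
      (∫ z in ball (0:ℂ) ρ, ‖z‖ ^ (2 * k)) ≤ κ⁻¹ * (T ^ 2) ^ n := fun k hk => by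
    have hb : ‖z - a‖ ≤ T * (ρ / 2) := by
      refine hza.trans ?_
      have := le_max_right 1 (2 * M / ρ)
      rw [← hT, div_le_iff₀ hρ] at this
      linarith
    rw [div_le_iff₀ (hw k), eval_pow, eval_X, norm_pow, ← pow_mul, mul_comm k]
    calc ‖z - a‖ ^ (2 * k) ≤ (T * (ρ / 2)) ^ (2 * k) := by gcongr
      _ = κ⁻¹ * (T ^ 2) ^ k * (κ * (ρ / 2) ^ (2 * k)) := by
        rw [mul_pow, pow_mul T]; field_simp
      _ ≤ κ⁻¹ * (T ^ 2) ^ n * (κ * (ρ / 2) ^ (2 * k)) := by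
        gcongr
        · exact one_le_pow₀ hT1
        · exact Nat.lt_succ_iff.1 (Finset.mem_range.1 hk)
      _ ≤ _ := by gcongr; exact hκle k
  have hmain := norm_sq_sum_le_of_orthogonal isBounded_ball hw
    (setIntegral_ball_pow_mul_conj_pow ρ) r.coeff (Finset.range (n + 1)) (z - a)
  simp only [← hrsum] at hmain
  rw [hreval, sub_add_cancel] at hmain
  have hsum := Finset.sum_le_card_nsmul _ _ _ hterm
  rw [Finset.card_range, nsmul_eq_mul] at hsum
  have hn2 : ((n + 1 : ℕ) : ℝ) ≤ 2 ^ n := by exact_mod_cast n.lt_two_pow_self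
  calc ‖q.eval z‖ ^ 2 ≤ _ := hmain
    _ ≤ (∫ w in D, ‖q.eval w‖ ^ 2) * (2 ^ n * (κ⁻¹ * (T ^ 2) ^ n)) := by
      refine mul_le_mul hI (hsum.trans (by gcongr)) ?_ hI0
      exact Finset.sum_nonneg fun k _ => div_nonneg (sq_nonneg _) (hw k).le
    _ = _ := by rw [mul_pow]; ring

/-- Polynomials that are geometrically small near `0` and geometrically close to `1` near `1`. -/
theorem exists_polynomial_amplifier (n : ℕ) :
    ∃ B : Polynomial ℂ, B.natDegree ≤ 2 * n ∧ ∀ δ : ℝ, δ ≤ 1 → ∀ x : ℂ,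
      (‖x‖ ≤ δ → ‖B.eval x‖ ≤ (8 * δ) ^ n) ∧
      (‖x - 1‖ ≤ δ → ‖B.eval x - 1‖ ≤ (8 * δ) ^ n) := by
  have hchoose : ∀ s : Finset ℕ, s ⊆ Finset.range (2 * n + 1) →
      ∑ i ∈ s, ((2 * n).choose i : ℝ) ≤ 4 ^ n := fun s hs => by
    refine (Finset.sum_le_sum_of_subset_of_nonneg hs fun _ _ _ => by positivity).trans ?_
    rw [show (4:ℝ) ^ n = ((2 ^ (2 * n) : ℕ) : ℝ) by rw [pow_mul]; norm_num,
      ← Nat.sum_range_choose]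
    push_cast
    rfl
  have heval : ∀ (i : ℕ) (x : ℂ), ‖(bernsteinPolynomial ℂ (2 * n) i).eval x‖ =
      (2 * n).choose i * (‖x‖ ^ i * ‖1 - x‖ ^ (2 * n - i)) := fun i x => by
    simp [bernsteinPolynomial, mul_assoc]
  have hbound : ∀ (i : ℕ) (x y δ : ℝ), 0 ≤ x → 0 ≤ y → x ≤ δ → y ≤ 2 → δ ≤ 1 → n ≤ i →
      i ≤ 2 * n → x ^ i * y ^ (2 * n - i) ≤ (2 * δ) ^ n := by
    intro i x y δ hx hy hxδ hy2 hδ hni hi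
    have hδ0 : 0 ≤ δ := hx.trans hxδ
    calc x ^ i * y ^ (2 * n - i) ≤ δ ^ i * 2 ^ (2 * n - i) := by gcongr
      _ ≤ δ ^ n * 2 ^ n := by
        gcongr ?_ * ?_
        · exact pow_le_pow_of_le_one hδ0 hδ hni
        · exact pow_le_pow_right₀ one_le_two (by omega)
      _ = _ := by rw [mul_pow, mul_comm]
  have hsum : ∀ (s : Finset ℕ) (x : ℂ) (δ : ℝ), s ⊆ Finset.range (2 * n + 1) →
      (∀ i ∈ s, ‖x‖ ^ i * ‖1 - x‖ ^ (2 * n - i) ≤ (2 * δ) ^ n) → 0 ≤ δ →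
      ‖(∑ i ∈ s, bernsteinPolynomial ℂ (2 * n) i).eval x‖ ≤ (8 * δ) ^ n := by
    intro s x δ hs h hδ
    rw [eval_finsetSum]
    calc _ ≤ ∑ i ∈ s, ‖(bernsteinPolynomial ℂ (2 * n) i).eval x‖ := norm_sum_le _ _
      _ ≤ ∑ i ∈ s, ((2 * n).choose i : ℝ) * (2 * δ) ^ n :=
        Finset.sum_le_sum fun i hi => by rw [heval]; gcongr; exact h i hi
      _ ≤ 4 ^ n * (2 * δ) ^ n := by rw [← Finset.sum_mul]; gcongr; exact hchoose s hs
      _ = _ := by rw [← mul_pow]; ring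
  have hsplit : ∑ i ∈ Finset.range n, bernsteinPolynomial ℂ (2 * n) i +
      ∑ i ∈ Finset.Ico n (2 * n + 1), bernsteinPolynomial ℂ (2 * n) i = 1 := by
    rw [Finset.sum_range_add_sum_Ico _ (by omega), bernsteinPolynomial.sum]
  refine ⟨∑ i ∈ Finset.Ico n (2 * n + 1), bernsteinPolynomial ℂ (2 * n) i,
    natDegree_sum_le_of_forall_le _ _ fun i hi => ?_, fun δ hδ x => ⟨fun hx => ?_, fun hx => ?_⟩⟩
  · rw [Finset.mem_Ico] at hi
    rw [bernsteinPolynomial, mul_assoc, ← Polynomial.C_eq_natCast]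
    refine (natDegree_C_mul_le _ _).trans (natDegree_mul_le.trans ?_)
    have h1 : ((1 : Polynomial ℂ) - X).natDegree ≤ 1 := by compute_degree
    have h2 := natDegree_pow_le_of_le (2 * n - i) h1
    rw [natDegree_X_pow]
    omega
  · refine hsum _ x δ (fun i hi => ?_) (fun i hi => ?_) ((norm_nonneg _).trans hx)
    · simp only [Finset.mem_Ico, Finset.mem_range] at hi ⊢; omega
    · rw [Finset.mem_Ico] at hi
      refine hbound i _ _ δ (norm_nonneg _) (norm_nonneg _) hx ?_ hδ hi.1 (by omega)
      refine (norm_sub_le _ _).trans ?_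
      rw [norm_one]; linarith
  · have h1 : (∑ i ∈ Finset.Ico n (2 * n + 1), bernsteinPolynomial ℂ (2 * n) i).eval x - 1 =
        -(∑ i ∈ Finset.range n, bernsteinPolynomial ℂ (2 * n) i).eval x := by
      have := congrArg (Polynomial.eval x) hsplit
      rw [eval_add, eval_one] at this
      linear_combination this
    rw [h1, norm_neg]
    refine hsum _ x δ (fun i hi => ?_) (fun i hi => ?_) ((norm_nonneg _).trans hx)
    · simp only [Finset.mem_range] at hi ⊢; omega
    · rw [Finset.mem_range] at hi
      have := hbound (2 * n - i) ‖1 - x‖ ‖x‖ δ (norm_nonneg _) (norm_nonneg _)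
        (by rwa [norm_sub_rev]) ?_ hδ (by omega) (by omega)
      · rwa [show 2 * n - (2 * n - i) = i by omega, mul_comm] at this
      · have := norm_add_le (x - 1) 1
        rw [sub_add_cancel, norm_one] at this
        linarith

/-- If `D` can be separated by polynomials from the remaining part `O`, the diagonal of the
Bergman kernel of `D` is dominated by that of `D ∪ O` at proportionally higher degree. -/
theorem exists_sum_norm_sq_le_four_mul {D O : Set ℂ} (hDo : IsOpen D)
    (hDb : Bornology.IsBounded D) (hDne : D.Nonempty) (hO : MeasurableSet O)
    (hOb : Bornology.IsBounded O) (hdisj : Disjoint D O)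
    (hsep : ∀ δ : ℝ, 0 < δ → ∃ p : Polynomial ℂ,
      (∀ w ∈ closure D, ‖p.eval w - 1‖ < δ) ∧ ∀ w ∈ O, ‖p.eval w‖ < δ)
    {P Q : ℕ → Polynomial ℂ} {lam mu : ℕ → ℝ} (hP : IsBergmanSystem (D ∪ O) P lam)
    (hQ : IsBergmanSystem D Q mu) :
    ∃ m : ℕ, 1 ≤ m ∧ ∀ n, 1 ≤ n → ∀ z ∈ closure D,
      ∑ k ∈ Finset.range (n + 1), ‖(Q k).eval z‖ ^ 2 ≤
        4 * ∑ k ∈ Finset.range (m * n + 1), ‖(P k).eval z‖ ^ 2 := by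
  obtain ⟨C, R, hC, hR, hgrow⟩ := exists_norm_sq_eval_le_of_isOpen hDo hDb hDne hOb
  have hOfin : volume O ≠ ⊤ := hOb.measure_lt_top.ne
  set A := volume.real O with hA
  have hA0 : 0 ≤ A := measureReal_nonneg
  have hden : 1 ≤ R * (1 + A * C) := one_le_mul_of_one_le_of_one_le hR (by nlinarith)
  set δ : ℝ := 1 / (128 * (R * (1 + A * C))) with hδ
  have hδ0 : 0 < δ := by positivity
  have hδ1 : δ ≤ 1 / 128 := by
    rw [hδ]; gcongr; linarith
  have hδA : 64 * δ ^ 2 * R * (A * C) ≤ 1 / 2 := by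
    have h1 : δ * (R * (1 + A * C)) = 1 / 128 := by rw [hδ]; field_simp
    have h2 : 0 ≤ A * C := by positivity
    have h3 : δ * (R * (A * C)) ≤ 1 / 128 := by nlinarith [mul_pos hδ0 (by linarith : 0 < R)]
    have h4 : 0 ≤ δ * (R * (A * C)) := by positivity
    nlinarith
  have hδR : 64 * δ ^ 2 * R ≤ 1 := by
    have h1 : δ * (R * (1 + A * C)) = 1 / 128 := by rw [hδ]; field_simp
    have h2 : 0 ≤ δ * R * (A * C) := by positivity
    have h3 : δ * R ≤ 1 / 128 := by nlinarith
    have h4 : 0 ≤ δ * R := by positivity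
    nlinarith
  obtain ⟨h, hh1, hh0⟩ := hsep δ hδ0
  refine ⟨2 * h.natDegree + 1, by omega, fun n hn z hz => ?_⟩
  obtain ⟨B, hBdeg, hB⟩ := exists_polynomial_amplifier n
  obtain ⟨q, hqdeg, hqz, hqI⟩ := hQ.exists_kernel hDb n z
  set S := ∑ k ∈ Finset.range (n + 1), ‖(Q k).eval z‖ ^ 2 with hS
  have hS0 : 0 ≤ S := Finset.sum_nonneg fun _ _ => sq_nonneg _
  set S' := ∑ k ∈ Finset.range ((2 * h.natDegree + 1) * n + 1), ‖(P k).eval z‖ ^ 2 with hS'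
  have hS'0 : 0 ≤ S' := Finset.sum_nonneg fun _ _ => sq_nonneg _
  have h8 : (8 * δ) ^ n ≤ 1 / 8 :=
    (pow_le_of_le_one (by positivity) (by linarith) (by omega)).trans (by linarith)
  have hT1 : ∀ w ∈ closure D, ‖(B.comp h).eval w - 1‖ ≤ 1 / 8 := fun w hw => by
    rw [eval_comp]
    exact ((hB δ (by linarith) _).2 (hh1 w hw).le).trans h8
  have hT0 : ∀ w ∈ O, ‖(B.comp h).eval w‖ ≤ (8 * δ) ^ n := fun w hw => by
    rw [eval_comp]
    exact (hB δ (by linarith) _).1 (hh0 w hw).le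
  have hdeg : (q * B.comp h).natDegree ≤ (2 * h.natDegree + 1) * n := by
    refine natDegree_mul_le.trans ?_
    rw [natDegree_comp]
    nlinarith [Nat.mul_le_mul_right h.natDegree hBdeg]
  have hIb : ∀ (p : Polynomial ℂ) {E : Set ℂ}, Bornology.IsBounded E →
      IntegrableOn (fun w => ‖p.eval w‖ ^ 2) E := fun p E hE =>
    Continuous.integrableOn_of_isBounded (by fun_prop) hE
  have hD : ∫ w in D, ‖(q * B.comp h).eval w‖ ^ 2 ≤ 81 / 64 * S := by
    rw [← hqI, ← integral_const_mul]
    refine setIntegral_mono_on (hIb _ hDb) ((hIb q hDb).const_mul _) hDo.measurableSet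
      fun w hw => ?_
    have h1 : ‖(B.comp h).eval w‖ ≤ 9 / 8 := by
      have h2 := hT1 w (subset_closure hw)
      have h3 := norm_add_le ((B.comp h).eval w - 1) 1
      rw [sub_add_cancel, norm_one] at h3
      linarith
    rw [eval_mul, norm_mul, mul_pow, mul_comm]
    gcongr
    calc ‖(B.comp h).eval w‖ ^ 2 ≤ (9 / 8) ^ 2 := by gcongr
      _ = _ := by norm_num
  have hOI : ∫ w in O, ‖(q * B.comp h).eval w‖ ^ 2 ≤ 1 / 2 * S := by
    have hpt : ∀ w ∈ O, ‖(q * B.comp h).eval w‖ ^ 2 ≤ C * S * (64 * δ ^ 2 * R) := fun w hw => by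
      have h1 := hgrow n q hqdeg w hw
      rw [hqI] at h1
      rw [eval_mul, norm_mul, mul_pow]
      calc ‖q.eval w‖ ^ 2 * ‖(B.comp h).eval w‖ ^ 2
          ≤ (C * R ^ n * S) * ((8 * δ) ^ n) ^ 2 := by gcongr; exact hT0 w hw
        _ = C * S * (64 * δ ^ 2 * R) ^ n := by
          rw [← pow_mul, mul_comm n 2, pow_mul, mul_pow _ R, mul_pow 8 δ 2]; norm_num; ring
        _ ≤ _ := by
          gcongr
          exact pow_le_of_le_one (by positivity) hδR (by omega)
    calc ∫ w in O, ‖(q * B.comp h).eval w‖ ^ 2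
        ≤ ∫ w in O, C * S * (64 * δ ^ 2 * R) :=
          setIntegral_mono_on (hIb _ hOb) (integrableOn_const hOfin) hO hpt
      _ = S * (64 * δ ^ 2 * R * (A * C)) := by
          rw [setIntegral_const, smul_eq_mul, ← hA]; ring
      _ ≤ S * (1 / 2) := by gcongr
      _ = _ := mul_comm _ _
  have hmain := hP.norm_sq_eval_le (hDb.union hOb) hdeg z
  rw [setIntegral_union hdisj hO (hIb _ hDb) (hIb _ hOb), ← hS', eval_mul, norm_mul, hqz]
    at hmain
  have hTz : 7 / 8 ≤ ‖(B.comp h).eval z‖ := by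
    have h2 := hT1 z hz
    have h3 := norm_sub_le ((B.comp h).eval z) ((B.comp h).eval z - 1)
    rw [sub_sub_cancel, norm_one] at h3
    linarith
  rcases hS0.eq_or_lt with h0 | hSpos
  · rw [← h0]; positivity
  have hfin : (S * (7 / 8)) ^ 2 ≤ (113 / 64 * S) * S' :=
    calc (S * (7 / 8)) ^ 2 ≤ (S * ‖(B.comp h).eval z‖) ^ 2 := by gcongr
      _ ≤ _ := hmain
      _ ≤ _ := by gcongr; linarith
  have : S * (49 * S) ≤ S * (113 * S') := by nlinarith
  have := le_of_mul_le_mul_left this hSpos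
  linarith

theorem IsJordanDomain.isOpen {D : Set ℂ} (hD : IsJordanDomain D) : IsOpen D := by
  obtain ⟨C, ⟨f, hf, -, rfl⟩, -, z, -, rfl⟩ := hD
  exact ((isCompact_sphere 0 1).image_of_continuousOn hf).isClosed.isOpen_compl.connectedComponentIn

theorem IsJordanDomain.isConnected {D : Set ℂ} (hD : IsJordanDomain D) : IsConnected D := by
  obtain ⟨C, -, -, z, hz, rfl⟩ := hD
  exact isConnected_connectedComponentIn_iff.2 hz

theorem IsJordanDomain.isBounded {D : Set ℂ} (hD : IsJordanDomain D) :
    Bornology.IsBounded D := by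
  obtain ⟨C, -, hb, -⟩ := hD
  exact hb

/-- The constant Bergman polynomial does not vanish. -/
theorem IsBergmanSystem.exists_sum_range_one {G : Set ℂ} {P : ℕ → Polynomial ℂ} {lam : ℕ → ℝ}
    (h : IsBergmanSystem G P lam) :
    ∃ a : ℝ, 0 < a ∧ ∀ z, (Real.sqrt (∑ k ∈ Finset.range 1, ‖(P k).eval z‖ ^ 2))⁻¹ = a := by
  have h0 : P 0 = Polynomial.C (lam 0 : ℂ) := by
    rw [← (h.2.1 0).2, leadingCoeff, h.1 0]
    exact eq_C_of_natDegree_eq_zero (h.1 0)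
  have hl := (h.2.1 0).1
  refine ⟨(lam 0)⁻¹, by positivity, fun z => ?_⟩
  simp [h0, Real.sqrt_sq_eq_abs, abs_of_pos hl]

/-- An island of an archipelago with analytic boundary has its Bergman kernel dominated by that
of the archipelago, at proportionally higher degree. -/
theorem IsArchipelago.exists_sum_norm_sq_le {N : ℕ} {Gs : Fin N → Set ℂ}
    (hArch : IsArchipelago Gs) {P Q : ℕ → Polynomial ℂ} {lam mu : ℕ → ℝ}
    (hP : IsBergmanSystem (⋃ j, Gs j) P lam) {j : Fin N}
    (hΓj : IsAnalyticJordanCurve (frontier (Gs j))) (hQ : IsBergmanSystem (Gs j) Q mu) :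
    ∃ m : ℕ, 1 ≤ m ∧ ∀ n, 1 ≤ n → ∀ z ∈ closure (Gs j),
      ∑ k ∈ Finset.range (n + 1), ‖(Q k).eval z‖ ^ 2 ≤
        4 * ∑ k ∈ Finset.range (m * n + 1), ‖(P k).eval z‖ ^ 2 := by
  obtain ⟨hJ, hdisj⟩ := hArch
  set O := ⋃ k ∈ Finset.univ.erase j, Gs k with hO
  set L := ⋃ k ∈ Finset.univ.erase j, closure (Gs k) with hL
  have hOL : O ⊆ L := iUnion₂_mono fun k _ => subset_closure
  have hLc : IsCompact L := (Finset.univ.erase j).isCompact_biUnion fun k _ =>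
    (hJ k).isBounded.isCompact_closure
  have hjL : Disjoint (closure (Gs j)) L := by
    rw [hL, disjoint_iUnion₂_right]
    exact fun k hk => hdisj j k (Finset.ne_of_mem_erase hk).symm
  have hunion : ⋃ k, Gs k = Gs j ∪ O := by
    ext z
    simp only [hO, mem_iUnion, mem_union, Finset.mem_erase, Finset.mem_univ, and_true, exists_prop]
    constructor
    · rintro ⟨k, hk⟩
      by_cases hkj : k = j
      · exact Or.inl (hkj ▸ hk)
      · exact Or.inr ⟨k, hkj, hk⟩
    · rintro (h | ⟨k, -, hk⟩)
      exacts [⟨j, h⟩, ⟨k, hk⟩]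
  rw [hunion] at hP
  refine exists_sum_norm_sq_le_four_mul (hJ j).isOpen (hJ j).isBounded (hJ j).isConnected.nonempty
    (isOpen_biUnion fun k _ => (hJ k).isOpen).measurableSet (hLc.isBounded.subset hOL)
    (hjL.mono subset_closure hOL) (fun δ hδ => ?_) hP hQ
  obtain ⟨p, hp1, hp0⟩ := exists_polynomial_separating (hJ j).isOpen (hJ j).isBounded
    (hJ j).isConnected hΓj hLc hjL (fun w hw => (hJ j).hasLogOn_closure hw) (fun w hw =>
      hasLogOn_biUnion _ (fun k _ => isClosed_closure) (fun k _ l _ hkl => hdisj k l hkl)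
        fun k hk => (hJ k).hasLogOn_closure fun h => hw (mem_biUnion hk h)) hδ
  exact ⟨p, hp1, fun w hw => hp0 w (hOL hw)⟩

/-- If `Γ_j = ∂G_j` is analytic then there are `γ_n ∈ (0,1)` tending to `0` geometrically
and an integer `m ≥ 1` with `((1-γ_n)/2)·Λ_{mn}(z) ≤ Λ_n^{G_j}(z)` on the closure of `G_j`. -/
theorem stmt2 (N : ℕ) (hN : 1 ≤ N) (Gs : Fin N → Set ℂ) (hArch : IsArchipelago Gs)
    (P : ℕ → Polynomial ℂ) (lam : ℕ → ℝ)
    (hP : IsBergmanSystem (⋃ j, Gs j) P lam)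
    (j : Fin N) (hΓj : IsAnalyticJordanCurve (frontier (Gs j)))
    (Pj : ℕ → Polynomial ℂ) (lamj : ℕ → ℝ)
    (hPj : IsBergmanSystem (Gs j) Pj lamj) :
    ∃ (γ : ℕ → ℝ) (C α : ℝ) (m : ℕ),
      (∀ n, 0 < γ n ∧ γ n < 1) ∧ 0 < C ∧ 0 < α ∧ α < 1 ∧
      (∀ n, γ n ≤ C * α ^ n) ∧ 1 ≤ m ∧
      ∀ (n : ℕ) (z : ℂ), z ∈ closure (Gs j) →
        (1 - γ n) / 2 *
            (Real.sqrt (∑ k ∈ Finset.range (m * n + 1), ‖(P k).eval z‖ ^ 2))⁻¹ ≤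
          (Real.sqrt (∑ k ∈ Finset.range (n + 1), ‖(Pj k).eval z‖ ^ 2))⁻¹ := by
  obtain ⟨m, hm, hle⟩ := hArch.exists_sum_norm_sq_le hP hΓj hPj
  obtain ⟨a, ha, haz⟩ := hP.exists_sum_range_one
  obtain ⟨b, hb, hbz⟩ := hPj.exists_sum_range_one
  set ε := min (1 / 2) (b / a) with hε
  have hε0 : 0 < ε := by positivity
  have hε2 : ε ≤ 1 / 2 := min_le_left _ _
  have hεa : ε * a ≤ b := by
    rw [← le_div_iff₀ ha]; exact min_le_right _ _
  refine ⟨fun n => if n = 0 then 1 - ε else (1 / 2) ^ n, 1, 1 / 2, m, fun n => ?_, one_pos,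
    by norm_num, by norm_num, fun n => ?_, hm, fun n z hz => ?_⟩
  · dsimp only
    split_ifs with hn
    · constructor <;> linarith
    · exact ⟨by positivity, pow_lt_one₀ (by norm_num) (by norm_num) hn⟩
  · dsimp only
    split_ifs with hn
    · subst hn; simp; exact hε0.le
    · simp
  · dsimp only
    split_ifs with hn
    · subst hn
      rw [mul_zero, zero_add, haz, hbz]
      nlinarith
    · have h1 := hle n (Nat.one_le_iff_ne_zero.2 hn) z hz
      set S := ∑ k ∈ Finset.range (n + 1), ‖(Pj k).eval z‖ ^ 2 with hS
      set S' := ∑ k ∈ Finset.range (m * n + 1), ‖(P k).eval z‖ ^ 2 with hS'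
      have hSpos : 0 < S := by
        have h0 := hbz z
        refine lt_of_lt_of_le (Real.sqrt_pos.1 (inv_pos.1 (h0 ▸ hb))) ?_
        exact Finset.sum_le_sum_of_subset_of_nonneg (Finset.range_mono (by omega))
          fun _ _ _ => sq_nonneg _
      have hsq : Real.sqrt S ≤ 2 * Real.sqrt S' := by
        rw [show (2:ℝ) = Real.sqrt 4 by rw [show (4:ℝ) = 2 ^ 2 by norm_num]; simp,
          ← Real.sqrt_mul (by norm_num)]
        exact Real.sqrt_le_sqrt h1
      calc (1 - (1 / 2) ^ n) / 2 * (Real.sqrt S')⁻¹ ≤ 1 / 2 * (Real.sqrt S')⁻¹ := by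
            gcongr
            have : (0:ℝ) < (1 / 2) ^ n := by positivity
            linarith
        _ = (2 * Real.sqrt S')⁻¹ := by rw [mul_inv]; norm_num
        _ ≤ (Real.sqrt S)⁻¹ := inv_anti₀ (Real.sqrt_pos.2 hSpos) hsq
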